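/- arXiv:2511.14298 — 3 statements merged into one kernel-verified Lean document; each statement's English description precedes it below -/
import Mathlib

section
/- For every natural number m there exists K such that for all k ≥ K there exist m finite posets, pairwise non-order-isomorphic, each of which minimally rainbow forces the antichain A_k. -/
/-- A (strong/induced) copy of the poset `P` in the poset `Q`: an injective map
reflecting and preserving the order. -/
def IsCopy {P Q : Type*} [PartialOrder P] [PartialOrder Q] (f : P → Q) : Prop :=
  Function.Injective f ∧ ∀ p p' : P, f p ≤ f p' ↔ p ≤ p'

/-- A proper coloring of a poset: distinct comparable elements get distinct colors. -/
def ProperColoring {Q : Type*} [PartialOrder Q] (c : Q → ℕ) : Prop :=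
  ∀ q q' : Q, q ≠ q' → (q ≤ q' ∨ q' ≤ q) → c q ≠ c q'

/-- `Q` rainbow forces `P`: every proper coloring of `Q` admits a rainbow copy of `P`. -/
def RainbowForces (Q : Type*) [PartialOrder Q] (P : Type*) [PartialOrder P] : Prop :=
  ∀ c : Q → ℕ, ProperColoring c → ∃ f : P → Q, IsCopy f ∧ Function.Injective (c ∘ f)

/-- `Q` minimally rainbow forces `P`: `Q` rainbow forces `P` but no one-element-deleted
induced subposet of `Q` does. -/
def MinRainbowForces (Q : Type*) [PartialOrder Q] (P : Type*) [PartialOrder P] : Prop :=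
  RainbowForces Q P ∧ ∀ q : Q, ¬RainbowForces {x : Q // x ≠ q} P

/-- The antichain poset `A_k` on `k` elements: `Fin k` ordered by equality. -/
def AC (k : ℕ) := Fin k

instance (k : ℕ) : PartialOrder (AC k) where
  le x y := x = y
  le_refl _ := rfl
  le_trans _ _ _ h h' := Eq.trans h h'
  le_antisymm _ _ h _ := h

instance (k : ℕ) : Fintype (AC k) := Fin.fintype k

/-- A bundled finite poset. -/
structure FinPoset where
  carrier : Type
  [po : PartialOrder carrier]
  [ft : Fintype carrier]

attribute [instance] FinPoset.po FinPoset.ft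

def ProperOff {Q : Type} [PartialOrder Q] (D : Set Q) (c : Q → ℕ) : Prop :=
  ∀ x y, x ∉ D → y ∉ D → x ≠ y → x ≤ y → c x ≠ c y

def RA {Q : Type} [PartialOrder Q] (D : Set Q) (c : Q → ℕ) (s : Finset Q) : Prop :=
  (∀ x ∈ s, x ∉ D) ∧ ∀ x ∈ s, ∀ y ∈ s, x ≠ y → ¬ x ≤ y ∧ c x ≠ c y

structure GG (Q : Type) [PartialOrder Q] (k : ℕ) : Prop where
  force : ∀ c : Q → ℕ, ProperOff ∅ c → ∃ s, RA ∅ c s ∧ s.card = k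
  mini : ∀ q : Q, ∃ c, ProperOff {q} c ∧ ∀ s, RA {q} c s → s.card < k
  col : ∃ c : Q → ℕ, ProperOff ∅ c ∧ ∀ x, c x < k

def Adv (X : Type) [PartialOrder X] (D : Set X) (t : ℕ) : Prop :=
  ∃ c : X → ℕ, ProperOff D c ∧ ∀ x y, x ∉ D → y ∉ D → ¬ x ≤ y → ¬ y ≤ x →
    t ≤ c x → t ≤ c y → c x = c y

structure WW (X : Type) [PartialOrder X] (n : ℕ) : Prop where
  force : ∀ c : X → ℕ, ProperOff ∅ c → ∀ S : Finset ℕ, S.card < n →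
    ∃ x y, ¬ x ≤ y ∧ ¬ y ≤ x ∧ c x ∉ S ∧ c y ∉ S ∧ c x ≠ c y
  mini : ∀ x : X, ∃ t, t + 1 = n ∧ Adv X {x} t
  adv : Adv X ∅ n
  width : ∀ x y z : X, ¬ x ≤ y → ¬ y ≤ x → ¬ y ≤ z → ¬ z ≤ y → ¬ x ≤ z → ¬ z ≤ x → False

theorem exists_color {a : ℕ} (c : Fin a → ℕ) (hc : ∀ x y, x ≠ y → x ≤ y → c x ≠ c y)
    (S : Finset ℕ) (hS : S.card < a) : ∃ x, c x ∉ S := by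
  by_contra! h
  have hinj : Function.Injective c := by
    intro x y hxy
    by_contra hne
    rcases le_total x y with h1 | h1
    · exact hc x y hne h1 hxy
    · exact hc y x (Ne.symm hne) h1 hxy.symm
  have : (Finset.univ.image c).card ≤ S.card :=
    Finset.card_le_card (by intro z hz; simp at hz; obtain ⟨x, rfl⟩ := hz; exact h x)
  rw [Finset.card_image_of_injective _ hinj] at this
  simp at this
  omega

theorem RA.card_le_of_lt {Q : Type} [PartialOrder Q] {D : Set Q} {c : Q → ℕ} {s : Finset Q}
    (h : RA D c s) {k : ℕ} (hk : ∀ x ∈ s, c x < k) : s.card ≤ k := by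
  have : s.card ≤ (Finset.range k).card := by
    apply Finset.card_le_card_of_injOn c
    · intro x hx; simpa using hk x hx
    · intro x hx y hy hxy
      by_contra hne
      exact (h.2 x hx y hy hne).2 hxy
  simpa using this

theorem GG_zero : GG Empty 0 where
  force c _ := ⟨∅, by simp [RA], rfl⟩
  mini q := q.elim
  col := ⟨fun _ => 0, by intro x; exact x.elim, by intro x; exact x.elim⟩

/-- compressed colouring of a chain with one element removed -/
def cmpr {a : ℕ} (p : Fin a) (t : Fin a) : ℕ := if t.val < p.val then t.val else t.val - 1

theorem cmpr_lt {a : ℕ} (p t : Fin a) (h : t ≠ p) : cmpr p t + 1 < a := by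
  have : t.val ≠ p.val := fun h' => h (Fin.ext h')
  unfold cmpr; split_ifs <;> omega

theorem cmpr_inj {a : ℕ} (p t u : Fin a) (h : t ≠ p) (h' : u ≠ p) (h2 : t ≠ u) :
    cmpr p t ≠ cmpr p u := by
  have : t.val ≠ p.val := fun h' => h (Fin.ext h')
  have : u.val ≠ p.val := fun h'' => h' (Fin.ext h'')
  have : t.val ≠ u.val := fun h' => h2 (Fin.ext h')
  unfold cmpr; split_ifs <;> omega

theorem RA.toLeft {Q X : Type} [PartialOrder Q] [PartialOrder X] {D : Set (Q ⊕ X)} {c : Q ⊕ X → ℕ}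
    {s : Finset (Q ⊕ X)} (h : RA D c s) : RA (Sum.inl ⁻¹' D) (c ∘ Sum.inl) s.toLeft := by
  refine ⟨fun x hx => h.1 _ (by simpa using hx), fun x hx y hy hne => ?_⟩
  have := h.2 (Sum.inl x) (by simpa using hx) (Sum.inl y) (by simpa using hy) (by simpa using hne)
  simpa using this

theorem RA.toRight {Q X : Type} [PartialOrder Q] [PartialOrder X] {D : Set (Q ⊕ X)} {c : Q ⊕ X → ℕ}
    {s : Finset (Q ⊕ X)} (h : RA D c s) : RA (Sum.inr ⁻¹' D) (c ∘ Sum.inr) s.toRight := by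
  refine ⟨fun x hx => h.1 _ (by simpa using hx), fun x hx y hy hne => ?_⟩
  have := h.2 (Sum.inr x) (by simpa using hx) (Sum.inr y) (by simpa using hy) (by simpa using hne)
  simpa using this

theorem ProperOff.sum {Q X : Type} [PartialOrder Q] [PartialOrder X] {D : Set Q} {E : Set X}
    {F : Set (Q ⊕ X)} {c : Q → ℕ} {d : X → ℕ} (hc : ProperOff D c) (hd : ProperOff E d)
    (h1 : Sum.inl ⁻¹' F = D) (h2 : Sum.inr ⁻¹' F = E) : ProperOff F (Sum.elim c d) := by
  subst h1 h2
  rintro (x | x) (y | y) hx hy hne hle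
  · exact hc x y hx hy (by simpa using hne) (by simpa using hle)
  · simp at hle
  · simp at hle
  · exact hd x y hx hy (by simpa using hne) (by simpa using hle)

theorem ProperOff.left {Q X : Type} [PartialOrder Q] [PartialOrder X]
    {c : Q ⊕ X → ℕ} (hc : ProperOff ∅ c) : ProperOff ∅ (c ∘ Sum.inl) := by
  intro x y _ _ hne hle
  exact hc _ _ (by simp) (by simp) (by simpa using hne) (by simpa using hle)

theorem ProperOff.right {Q X : Type} [PartialOrder Q] [PartialOrder X]
    {c : Q ⊕ X → ℕ} (hc : ProperOff ∅ c) : ProperOff ∅ (c ∘ Sum.inr) := by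
  intro x y _ _ hne hle
  exact hc _ _ (by simp) (by simp) (by simpa using hne) (by simpa using hle)

theorem val_proper {a : ℕ} (D : Set (Fin a)) : ProperOff D (fun t : Fin a => t.val) := by
  intro x y _ _ hne _ h
  exact hne (Fin.ext h)

theorem cmpr_proper {a : ℕ} (p : Fin a) : ProperOff {p} (cmpr p) := by
  intro x y hx hy hne _
  exact cmpr_inj p x y (by simpa using hx) (by simpa using hy) hne

theorem pre_ll {Q X : Type} (q : Q) : (Sum.inl ⁻¹' ({Sum.inl q} : Set (Q ⊕ X))) = {q} := by
  ext; simp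
theorem pre_lr {Q X : Type} (q : Q) : (Sum.inr ⁻¹' ({Sum.inl q} : Set (Q ⊕ X))) = ∅ := by
  ext; simp
theorem pre_rl {Q X : Type} (q : X) : (Sum.inl ⁻¹' ({Sum.inr q} : Set (Q ⊕ X))) = ∅ := by
  ext; simp
theorem pre_rr {Q X : Type} (q : X) : (Sum.inr ⁻¹' ({Sum.inr q} : Set (Q ⊕ X))) = {q} := by
  ext; simp

theorem RA.disjSum {Q X : Type} [PartialOrder Q] [PartialOrder X] {c : Q ⊕ X → ℕ}
    {s : Finset Q} {t : Finset X} (hs : RA ∅ (c ∘ Sum.inl) s) (ht : RA ∅ (c ∘ Sum.inr) t)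
    (h : ∀ x ∈ s, ∀ y ∈ t, c (Sum.inl x) ≠ c (Sum.inr y)) : RA ∅ c (s.disjSum t) := by
  refine ⟨by simp, ?_⟩
  rintro (x | x) hx (y | y) hy hne
  · simpa using hs.2 x (by simpa using hx) y (by simpa using hy) (by simpa using hne)
  · simpa using h x (by simpa using hx) y (by simpa using hy)
  · simpa using (h y (by simpa using hy) x (by simpa using hx)).symm
  · simpa using ht.2 x (by simpa using hx) y (by simpa using hy) (by simpa using hne)

theorem GG_succ {Q : Type} [PartialOrder Q] {k : ℕ} (h : GG Q k) : GG (Q ⊕ Fin (k + 1)) (k + 1) where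
  force c hc := by
    obtain ⟨s, hs, hcard⟩ := h.force _ hc.left
    obtain ⟨y, hy⟩ := exists_color (c ∘ Sum.inr)
      (fun x y h1 h2 => hc.right x y (by simp) (by simp) h1 h2) (s.image (c ∘ Sum.inl))
      (by have := Finset.card_image_le (s := s) (f := c ∘ Sum.inl); omega)
    refine ⟨s.disjSum {y}, hs.disjSum ⟨by simp, by simp⟩ ?_, by simp [hcard]⟩
    intro x hx y' hy' he
    simp at hy'
    subst hy'
    exact hy (Finset.mem_image.2 ⟨x, hx, he⟩)
  mini q := by
    rcases q with q | q
    · obtain ⟨c, hc, hs⟩ := h.mini q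
      refine ⟨_, hc.sum (val_proper ∅) (pre_ll q) (pre_lr q), fun s hR => ?_⟩
      have h1 := hR.toLeft
      rw [pre_ll] at h1
      have h2 := hs _ h1
      have h3 : s.toRight.card ≤ 1 := by
        rw [Finset.card_le_one]
        intro x hx y hy
        by_contra hne
        rcases le_total x y with h | h
        · exact (hR.toRight.2 x hx y hy hne).1 h
        · exact (hR.toRight.2 y hy x hx (Ne.symm hne)).1 h
      have := s.card_toLeft_add_card_toRight
      omega
    · obtain ⟨c, hc, hk⟩ := h.col
      refine ⟨_, hc.sum (cmpr_proper q) (pre_rl q) (pre_rr q), fun s hR => ?_⟩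
      have : s.card ≤ k := by
        apply hR.card_le_of_lt
        rintro (x | x) hx
        · exact hk x
        · have := cmpr_lt q x (by rintro rfl; exact hR.1 _ hx rfl)
          simp only [Sum.elim_inr]; omega
      omega
  col := by
    obtain ⟨c, hc, hk⟩ := h.col
    refine ⟨_, hc.sum (val_proper ∅) rfl rfl, ?_⟩
    rintro (x | x)
    · have := hk x
      simp only [Sum.elim_inl]; omega
    · exact x.2

theorem exists_GG (k : ℕ) : ∃ Q : FinPoset, GG Q.carrier k := by
  induction k with
  | zero => exact ⟨⟨Empty⟩, GG_zero⟩
  | succ k ih =>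
    obtain ⟨Q, hQ⟩ := ih
    exact ⟨⟨Q.carrier ⊕ Fin (k + 1)⟩, GG_succ hQ⟩

/-- the final combination -/
structure MM (Q : Type) [PartialOrder Q] (k : ℕ) : Prop where
  force : ∀ c : Q → ℕ, ProperOff ∅ c → ∃ s, RA ∅ c s ∧ s.card = k
  mini : ∀ q : Q, ∃ c, ProperOff {q} c ∧ ∀ s, RA {q} c s → s.card < k

theorem MM_of {Q X : Type} [PartialOrder Q] [PartialOrder X] [Fintype X] {k : ℕ} (h : GG Q k)
    (hX : WW X (k + 1)) : MM (Q ⊕ X) (k + 2) where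
  force c hc := by
    classical
    obtain ⟨s, hs, hcard⟩ := h.force _ hc.left
    obtain ⟨x, y, hxy, hyx, hx, hy, hne⟩ := hX.force _ hc.right (s.image (c ∘ Sum.inl))
      (by have := Finset.card_image_le (s := s) (f := c ∘ Sum.inl); omega)
    have hxny : x ≠ y := by rintro rfl; exact hne rfl
    refine ⟨s.disjSum {x, y}, hs.disjSum ⟨by simp, ?_⟩ ?_, ?_⟩
    · intro u hu v hv huv
      simp only [Finset.mem_insert, Finset.mem_singleton] at hu hv
      rcases hu with rfl | rfl <;> rcases hv with rfl | rfl
      · exact absurd rfl huv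
      · exact ⟨hxy, hne⟩
      · exact ⟨hyx, hne.symm⟩
      · exact absurd rfl huv
    · intro u hu v hv he
      simp only [Finset.mem_insert, Finset.mem_singleton] at hv
      rcases hv with rfl | rfl
      · exact hx (Finset.mem_image.2 ⟨u, hu, he⟩)
      · exact hy (Finset.mem_image.2 ⟨u, hu, he⟩)
    · rw [Finset.card_disjSum, hcard, Finset.card_pair hxny]
  mini q := by
    classical
    rcases q with q | q
    · obtain ⟨c, hc, hs⟩ := h.mini q
      have hd : ProperOff ∅ (fun x : X => (Fintype.equivFin X x).val) := by
        intro x y _ _ hne _ he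
        exact hne ((Fintype.equivFin X).injective (Fin.ext he))
      refine ⟨_, hc.sum hd (pre_ll q) (pre_lr q), fun s hR => ?_⟩
      have h1 := hR.toLeft
      rw [pre_ll] at h1
      have h2 := hs _ h1
      have h3 : s.toRight.card ≤ 2 := by
        by_contra! hlt
        obtain ⟨x, y, z, hx, hy, hz, hxy, hxz, hyz⟩ := Finset.two_lt_card_iff.1 hlt
        have := hR.toRight.2
        exact hX.width x y z (this x hx y hy hxy).1 (this y hy x hx hxy.symm).1
          (this y hy z hz hyz).1 (this z hz y hy hyz.symm).1
          (this x hx z hz hxz).1 (this z hz x hx hxz.symm).1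
      have := s.card_toLeft_add_card_toRight
      omega
    · obtain ⟨c, hc, hk⟩ := h.col
      obtain ⟨t, ht, d, hd, hd2⟩ := hX.mini q
      obtain rfl : t = k := by omega
      refine ⟨_, hc.sum hd (pre_rl q) (pre_rr q), fun s hR => ?_⟩
      have h1 : (s.filter (fun x => Sum.elim c d x < t)).card ≤ t := by
        apply RA.card_le_of_lt (D := {Sum.inr q}) (c := Sum.elim c d)
        · exact ⟨fun x hx => hR.1 x (Finset.mem_filter.1 hx).1, fun x hx y hy =>
            hR.2 x (Finset.mem_filter.1 hx).1 y (Finset.mem_filter.1 hy).1⟩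
        · exact fun x hx => (Finset.mem_filter.1 hx).2
      have h2 : (s.filter (fun x => ¬ Sum.elim c d x < t)).card ≤ 1 := by
        rw [Finset.card_le_one]
        intro x hx y hy
        rw [Finset.mem_filter] at hx hy
        by_contra hne
        rcases x with x | x
        · exact hx.2 (hk x)
        rcases y with y | y
        · exact hy.2 (hk y)
        have a1 := hR.2 _ hx.1 _ hy.1 hne
        have a2 := hR.2 _ hy.1 _ hx.1 (Ne.symm hne)
        apply a1.2
        refine hd2 x y (fun h => hR.1 _ hx.1 (by rw [Set.mem_singleton_iff] at h; rw [h]; rfl))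
          (fun h => hR.1 _ hy.1 (by rw [Set.mem_singleton_iff] at h; rw [h]; rfl))
          (by simpa using a1.1) (by simpa using a2.1) ?_ ?_
        · simpa using hx.2
        · simpa using hy.2
      have := Finset.card_filter_add_card_filter_not (s := s) (fun x => Sum.elim c d x < t)
      omega

theorem WW_base (a : ℕ) : WW (Fin (a + 1) ⊕ Fin (a + 2)) (a + 1) where
  force c hc S hS := by
    obtain ⟨x, hx⟩ := exists_color (c ∘ Sum.inl)
      (fun x y h1 h2 => hc.left x y (by simp) (by simp) h1 h2) S (by omega)
    obtain ⟨y, hy⟩ := exists_color (c ∘ Sum.inr)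
      (fun x y h1 h2 => hc.right x y (by simp) (by simp) h1 h2) (insert (c (Sum.inl x)) S)
      (by have := Finset.card_insert_le (c (Sum.inl x)) S; omega)
    simp only [Finset.mem_insert, not_or, Function.comp] at hx hy
    exact ⟨Sum.inl x, Sum.inr y, by simp, by simp, hx, hy.2, Ne.symm hy.1⟩
  mini q := by
    refine ⟨a, rfl, ?_⟩
    rcases q with q | q
    · refine ⟨_, (cmpr_proper q).sum (val_proper ∅) (pre_ll q) (pre_lr q), ?_⟩
      rintro (x | x) (y | y) hx hy h1 h2 h3 h4
      · have := cmpr_lt q x (by rintro rfl; exact hx rfl)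
        simp only [Sum.elim_inl] at h3; omega
      · have := cmpr_lt q x (by rintro rfl; exact hx rfl)
        simp only [Sum.elim_inl] at h3; omega
      · have := cmpr_lt q y (by rintro rfl; exact hy rfl)
        simp only [Sum.elim_inl] at h4; omega
      · rcases le_total x y with h | h
        · exact absurd (Sum.inr_le_inr_iff.2 h) h1
        · exact absurd (Sum.inr_le_inr_iff.2 h) h2
    · refine ⟨_, (val_proper ∅).sum (cmpr_proper q) (pre_rl q) (pre_rr q), ?_⟩
      have hl : ∀ x : Fin (a + 1) ⊕ Fin (a + 2), x ∉ ({Sum.inr q} : Set _) →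
          Sum.elim (fun t : Fin (a + 1) => t.val) (cmpr q) x ≤ a := by
        rintro (x | x) hx
        · simp only [Sum.elim_inl]; omega
        · have := cmpr_lt q x (by rintro rfl; exact hx rfl)
          simp only [Sum.elim_inr]; omega
      intro x y hx hy _ _ h3 h4
      have := hl x hx
      have := hl y hy
      omega
  adv := by
    refine ⟨_, (val_proper ∅).sum (val_proper ∅) rfl rfl, ?_⟩
    rintro (x | x) (y | y) hx hy h1 h2 h3 h4
    · simp only [Sum.elim_inl] at h3; omega
    · simp only [Sum.elim_inl] at h3; omega
    · simp only [Sum.elim_inl] at h4; omega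
    · rcases le_total x y with h | h
      · exact absurd (Sum.inr_le_inr_iff.2 h) h1
      · exact absurd (Sum.inr_le_inr_iff.2 h) h2
  width := by
    rintro (x | x) (y | y) (z | z) <;> simp <;> omega

theorem Adv.lex {X Y : Type} [PartialOrder X] [PartialOrder Y] {D : Set X} {E : Set Y}
    {F : Set (X ⊕ₗ Y)} {t u : ℕ} (h : Adv X D t) (h' : Adv Y E u)
    (h1 : ∀ x, toLex (Sum.inl x) ∈ F ↔ x ∈ D) (h2 : ∀ x, toLex (Sum.inr x) ∈ F ↔ x ∈ E) :
    Adv (X ⊕ₗ Y) F (t + u) := by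
  obtain ⟨c, hc, hc'⟩ := h
  obtain ⟨d, hd, hd'⟩ := h'
  refine ⟨fun z => Sum.elim (fun x => if c x < t then c x else 2 * c x + t + u)
    (fun y => if d y < u then d y + t else 2 * d y + 1 + t + u) (ofLex z), ?_, ?_⟩
  · intro x y
    obtain ⟨x, rfl⟩ := toLex.surjective x
    obtain ⟨y, rfl⟩ := toLex.surjective y
    rcases x with x | x <;> rcases y with y | y <;>
      simp only [h1, h2, ofLex_toLex, Sum.elim_inl, Sum.elim_inr, Sum.Lex.inl_le_inl_iff,
        Sum.Lex.inr_le_inr_iff, Sum.Lex.not_inr_le_inl, ne_eq, EmbeddingLike.apply_eq_iff_eq,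
        Sum.inl.injEq, Sum.inr.injEq]
    · intro a1 a2 a3 a4
      have := hc x y a1 a2 a3 a4
      split_ifs <;> omega
    · intro _ _ _ _
      split_ifs <;> omega
    · simp
    · intro a1 a2 a3 a4
      have := hd x y a1 a2 a3 a4
      split_ifs <;> omega
  · intro x y
    obtain ⟨x, rfl⟩ := toLex.surjective x
    obtain ⟨y, rfl⟩ := toLex.surjective y
    rcases x with x | x <;> rcases y with y | y <;>
      simp only [h1, h2, ofLex_toLex, Sum.elim_inl, Sum.elim_inr, Sum.Lex.inl_le_inl_iff,
        Sum.Lex.inr_le_inr_iff, Sum.Lex.not_inr_le_inl, Sum.Lex.inl_le_inr]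
    · intro a1 a2 a3 a4
      have := hc' x y a1 a2 a3 a4
      split_ifs <;> omega
    · simp
    · simp
    · intro a1 a2 a3 a4
      have := hd' x y a1 a2 a3 a4
      split_ifs <;> omega

theorem WW.lex {X Y : Type} [PartialOrder X] [PartialOrder Y] {n p : ℕ} (hX : WW X n)
    (hY : WW Y p) : WW (X ⊕ₗ Y) (n + p) where
  force c hc S hS := by
    classical
    have hl : ProperOff ∅ (fun x : X => c (toLex (Sum.inl x))) := by
      intro x y _ _ hne hle
      exact hc _ _ (by simp) (by simp) (by simpa using hne) (by simpa using hle)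
    have hr : ProperOff ∅ (fun x : Y => c (toLex (Sum.inr x))) := by
      intro x y _ _ hne hle
      exact hc _ _ (by simp) (by simp) (by simpa using hne) (by simpa using hle)
    let S1 := S.filter (fun z => ∃ x : X, c (toLex (Sum.inl x)) = z)
    let S2 := S.filter (fun z => ¬ ∃ x : X, c (toLex (Sum.inl x)) = z)
    have hsum : S1.card + S2.card = S.card := Finset.card_filter_add_card_filter_not _
    by_cases h1 : S1.card < n
    · obtain ⟨x, y, a1, a2, a3, a4, a5⟩ := hX.force _ hl S1 h1
      refine ⟨toLex (Sum.inl x), toLex (Sum.inl y), by simpa using a1, by simpa using a2, ?_, ?_, a5⟩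
      · exact fun h => a3 (Finset.mem_filter.2 ⟨h, x, rfl⟩)
      · exact fun h => a4 (Finset.mem_filter.2 ⟨h, y, rfl⟩)
    · obtain ⟨x, y, a1, a2, a3, a4, a5⟩ := hY.force _ hr S2 (by omega)
      have key : ∀ (w : Y), ¬ ∃ x : X, c (toLex (Sum.inl x)) = c (toLex (Sum.inr w)) := by
        rintro w ⟨x, hx⟩
        exact hc _ _ (by simp) (by simp) (by simp) (Sum.Lex.inl_le_inr x w) hx
      refine ⟨toLex (Sum.inr x), toLex (Sum.inr y), by simpa using a1, by simpa using a2, ?_, ?_, a5⟩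
      · exact fun h => a3 (Finset.mem_filter.2 ⟨h, key x⟩)
      · exact fun h => a4 (Finset.mem_filter.2 ⟨h, key y⟩)
  mini q := by
    obtain ⟨q, rfl⟩ := toLex.surjective q
    rcases q with q | q
    · obtain ⟨t, ht, h⟩ := hX.mini q
      exact ⟨t + p, by omega, h.lex hY.adv (by simp) (by simp)⟩
    · obtain ⟨t, ht, h⟩ := hY.mini q
      exact ⟨n + t, by omega, hX.adv.lex h (by simp) (by simp)⟩
  adv := hX.adv.lex hY.adv (by simp) (by simp)
  width x y z := by
    obtain ⟨x, rfl⟩ := toLex.surjective x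
    obtain ⟨y, rfl⟩ := toLex.surjective y
    obtain ⟨z, rfl⟩ := toLex.surjective z
    rcases x with x | x <;> rcases y with y | y <;> rcases z with z | z <;> simp
    · simpa using hX.width x y z
    · simpa using hY.width x y z

theorem exists_WW (b i : ℕ) : ∃ X : FinPoset, WW X.carrier (b + 1 + i) ∧
    Fintype.card X.carrier = 3 * i + 2 * b + 3 := by
  induction i with
  | zero => exact ⟨⟨Fin (b + 1) ⊕ Fin (b + 2)⟩, WW_base b, by simp; omega⟩
  | succ i ih =>
    obtain ⟨X, hX, hc⟩ := ih
    refine ⟨⟨(Fin (0 + 1) ⊕ Fin (0 + 2)) ⊕ₗ X.carrier⟩, ?_, ?_⟩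
    · have := (WW_base 0).lex hX
      rwa [show 0 + 1 + (b + 1 + i) = b + 1 + (i + 1) by omega] at this
    · have : Fintype.card ((Fin (0 + 1) ⊕ Fin (0 + 2)) ⊕ₗ X.carrier) = 3 + Fintype.card X.carrier := by
        rw [Fintype.card_lex]; simp
      refine Eq.trans this ?_
      omega

theorem MM.min {Q : Type} [PartialOrder Q] {k : ℕ} (h : MM Q k) : MinRainbowForces Q (AC k) := by
  classical
  constructor
  · intro c hc
    obtain ⟨s, hs, hk⟩ := h.force c (fun x y _ _ hne hle => hc x y hne (Or.inl hle))
    let e : Fin k ≃ s := (finCongr hk.symm).trans s.equivFin.symm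
    have hne : ∀ p p' : AC k, p ≠ p' → (e p : Q) ≠ e p' := by
      intro p p' hp he
      exact hp (e.injective (Subtype.ext he))
    refine ⟨fun p => (e p : Q), ⟨?_, ?_⟩, ?_⟩
    · intro p p' he
      by_contra hp
      exact hne p p' hp he
    · intro p p'
      constructor
      · intro hle
        by_contra hp
        exact (hs.2 _ (e p).2 _ (e p').2 (hne p p' hp)).1 hle
      · intro hle
        have : p = p' := hle
        rw [this]
    · intro p p' he
      by_contra hp
      exact (hs.2 _ (e p).2 _ (e p').2 (hne p p' hp)).2 he
  · intro q hq
    obtain ⟨c, hc, hs⟩ := h.mini q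
    obtain ⟨f, hf, hi⟩ := hq (fun x => c x.1) (by
      intro x y hne hor
      have hne' : x.1 ≠ y.1 := fun h => hne (Subtype.ext h)
      rcases hor with h | h
      · exact hc x y x.2 y.2 hne' h
      · exact (hc y x y.2 x.2 hne'.symm h).symm)
    have hinj : Function.Injective (fun p => (f p : Q)) := fun p p' he => hf.1 (Subtype.ext he)
    have := hs (Finset.univ.image (fun p => (f p : Q))) ⟨?_, ?_⟩
    · rw [Finset.card_image_of_injective _ hinj] at this
      have h2 : (Finset.univ : Finset (AC k)).card = k := Finset.card_fin k
      omega
    · intro x hx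
      simp only [Finset.mem_image] at hx
      obtain ⟨p, _, rfl⟩ := hx
      exact (f p).2
    · intro x hx y hy hne
      simp only [Finset.mem_image] at hx hy
      obtain ⟨p, _, rfl⟩ := hx
      obtain ⟨p', _, rfl⟩ := hy
      refine ⟨fun hle => ?_, fun he => ?_⟩
      · have : p = p' := (hf.2 p p').1 hle
        exact hne (by rw [this])
      · have : p = p' := hi he
        exact hne (by rw [this])

/-- For every `m` there exists `K` such that for all `k ≥ K` there exist `m`
pairwise non-order-isomorphic finite posets, each of which minimally rainbow forces the
antichain `A_k`. -/
theorem statement12 (m : ℕ) :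
    ∃ K : ℕ, ∀ k, K ≤ k →
      ∃ Q : Fin m → FinPoset,
        (∀ i j, i ≠ j → IsEmpty ((Q i).carrier ≃o (Q j).carrier)) ∧
        ∀ i, MinRainbowForces (Q i).carrier (AC k) := by
  refine ⟨m + 2, fun k hk => ?_⟩
  obtain ⟨k, rfl⟩ : ∃ k', k = k' + 2 := ⟨k - 2, by omega⟩
  obtain ⟨Q, hQ⟩ := exists_GG k
  have hX : ∀ i : Fin m, ∃ X : FinPoset, WW X.carrier (k + 1) ∧
      Fintype.card X.carrier = 3 * i.val + 2 * (k - i.val) + 3 := by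
    intro i
    have := exists_WW (k - i.val) i.val
    rwa [show k - i.val + 1 + i.val = k + 1 by omega] at this
  choose X hW hcard using hX
  refine ⟨fun i => ⟨Q.carrier ⊕ (X i).carrier⟩, ?_, fun i => (MM_of hQ (hW i)).min⟩
  intro i j hij
  refine ⟨fun e => hij (Fin.ext ?_)⟩
  have h1 := Fintype.card_congr (e.toEquiv : Q.carrier ⊕ (X i).carrier ≃ Q.carrier ⊕ (X j).carrier)
  rw [Fintype.card_sum, Fintype.card_sum, hcard, hcard] at h1
  omega
end

section
/- For all s, t ≥ 2 and every ε > 0 there exists n₀ such that for all n ≥ n₀, (s + t − ε) · C(n, ⌊n/2⌋) ≤ La_R*(n,K_{s,t}) ≤ (s + t + ε) · C(n, ⌊n/2⌋). -/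
/-- A copy of the poset `P` in the family `𝓕` of subsets of `[n]`. -/
def FamilyCopy (n : ℕ) (𝓕 : Finset (Finset (Fin n))) (P : Type*) [PartialOrder P]
    (f : P → Finset (Fin n)) : Prop :=
  (∀ p, f p ∈ 𝓕) ∧ Function.Injective f ∧ ∀ p p' : P, f p ⊆ f p' ↔ p ≤ p'

/-- A proper coloring of a family of sets: distinct members related by inclusion get
distinct colors. -/
def FamilyProperColoring (n : ℕ) (𝓕 : Finset (Finset (Fin n)))
    (c : Finset (Fin n) → ℕ) : Prop :=
  ∀ A ∈ 𝓕, ∀ B ∈ 𝓕, A ≠ B → A ⊆ B → c A ≠ c B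

/-- `𝓕` admits a proper coloring with no rainbow copy of `P`. -/
def AvoidsRainbow (n : ℕ) (P : Type*) [PartialOrder P] (𝓕 : Finset (Finset (Fin n))) : Prop :=
  ∃ c : Finset (Fin n) → ℕ, FamilyProperColoring n 𝓕 c ∧
    ¬∃ f : P → Finset (Fin n), FamilyCopy n 𝓕 P f ∧ Function.Injective (c ∘ f)

/-- `La_R^*(n,P)`: the maximum size of a family of subsets of `[n]` admitting a proper
coloring with no rainbow copy of `P`. -/
noncomputable def LaR (n : ℕ) (P : Type*) [PartialOrder P] : ℕ :=
  sSup {m : ℕ | ∃ 𝓕 : Finset (Finset (Fin n)), 𝓕.card = m ∧ AvoidsRainbow n P 𝓕}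

open Finset in
/-- Permutations (viewed as position maps) whose maximal chain passes through `A`. -/
def NA {n : ℕ} (A : Finset (Fin n)) : Finset (Equiv.Perm (Fin n)) :=
  univ.filter (fun σ => ∀ x, (σ x : ℕ) < A.card ↔ x ∈ A)

theorem mem_NA {n : ℕ} {A : Finset (Fin n)} {σ : Equiv.Perm (Fin n)} :
    σ ∈ NA A ↔ ∀ x, (σ x : ℕ) < A.card ↔ x ∈ A := by
  simp [NA]

theorem NA_subset_of_card {n : ℕ} {A B : Finset (Fin n)} {σ : Equiv.Perm (Fin n)}
    (hA : σ ∈ NA A) (hB : σ ∈ NA B) (h : A.card ≤ B.card) : A ⊆ B := by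
  intro x hx
  rw [mem_NA] at hA hB
  exact (hB x).1 (lt_of_lt_of_le ((hA x).2 hx) h)

theorem NA_card_le {n : ℕ} {A B : Finset (Fin n)} (h : A.card = B.card) :
    (NA B).card ≤ (NA A).card := by
  classical
  let e : {x // x ∈ A} ≃ {x // x ∈ B} := Finset.equivOfCardEq h
  let τ : Equiv.Perm (Fin n) := e.extendSubtype
  have hτ : ∀ x, τ x ∈ B ↔ x ∈ A := by
    intro x
    constructor
    · intro hx
      by_contra hxA
      exact e.extendSubtype_not_mem x hxA hx
    · intro hx
      exact e.extendSubtype_mem x hx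
  apply Finset.card_le_card_of_injOn (fun σ => τ.trans σ)
  · intro σ hσ
    have hσ := mem_NA.1 hσ
    refine mem_NA.2 fun x => ?_
    rw [← hτ x, ← hσ (τ x), h]
    rfl
  · intro a _ b _ hab
    ext x
    have := congrArg (fun f : Equiv.Perm (Fin n) => (f (τ.symm x) : ℕ)) hab
    simpa using this

theorem exists_NA_level {n k : ℕ} (hk : k ≤ n) (σ : Equiv.Perm (Fin n)) :
    ∃ A : Finset (Fin n), A.card = k ∧ σ ∈ NA A := by
  classical
  have hc : (Finset.univ.filter (fun x : Fin n => (σ x : ℕ) < k)).card = k := by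
    have h1 : (Finset.univ.filter (fun x : Fin n => (σ x : ℕ) < k)).map σ.toEmbedding
        = Finset.univ.filter (fun x : Fin n => (x : ℕ) < k) := by
      ext y
      simp only [Finset.mem_map, Finset.mem_filter, Finset.mem_univ, true_and,
        Equiv.coe_toEmbedding]
      constructor
      · rintro ⟨x, hx, rfl⟩; exact hx
      · intro hy; exact ⟨σ.symm y, by simpa using hy, by simp⟩
    have h2 := congrArg Finset.card h1
    rw [Finset.card_map] at h2
    rw [h2, Fin.card_filter_val_lt]
    omega
  exact ⟨_, hc, mem_NA.2 fun x => by rw [hc]; simp⟩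

theorem choose_mul_NA {n : ℕ} (A : Finset (Fin n)) :
    n.choose A.card * (NA A).card = n.factorial := by
  classical
  have h : ∑ B ∈ (Finset.univ : Finset (Fin n)).powersetCard A.card, (NA B).card = n.factorial := by
    rw [← Finset.card_biUnion]
    · have : ((Finset.univ : Finset (Fin n)).powersetCard A.card).biUnion NA = Finset.univ := by
        ext σ
        simp only [Finset.mem_biUnion, Finset.mem_univ, iff_true, Finset.mem_powersetCard,
          Finset.subset_univ, true_and]
        exact exists_NA_level (by simpa using A.card_le_univ) σ
      rw [this, Finset.card_univ, Fintype.card_perm, Fintype.card_fin]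
    · intro B hB C hC hBC
      rw [Function.onFun, Finset.disjoint_left]
      intro σ h1 h2
      have hB := (Finset.mem_powersetCard.1 hB).2
      have hC := (Finset.mem_powersetCard.1 hC).2
      exact hBC ((NA_subset_of_card h1 h2 (by omega)).antisymm
        (NA_subset_of_card h2 h1 (by omega)))
  rw [← h, Finset.sum_congr rfl (g := fun _ => (NA A).card)]
  · simp
  · intro B hB
    have hB := (Finset.mem_powersetCard.1 hB).2
    exact le_antisymm (NA_card_le hB.symm) (NA_card_le hB)

theorem fiber_bound {n : ℕ} (A B : Finset (Fin n)) (x i : Fin n)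
    (hB : ∀ y ∈ B, (y ∈ A ↔ x ∈ A)) :
    ((NA A).filter (fun σ => σ x = i)).card * B.card ≤ (NA A).card := by
  classical
  have h1 : ∀ y ∈ B, ((NA A).filter (fun σ => σ x = i)).card ≤
      ((NA A).filter (fun σ => σ y = i)).card := by
    intro y hy
    apply Finset.card_le_card_of_injOn (fun σ => (Equiv.swap x y).trans σ)
    · intro σ hσ
      have hσ := Finset.mem_filter.1 hσ
      have h := mem_NA.1 hσ.1
      refine Finset.mem_filter.2 ⟨mem_NA.2 fun z => ?_, ?_⟩
      · have hxy := hB y hy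
        rw [Equiv.trans_apply, h]
        rcases eq_or_ne z x with rfl | hzx
        · simpa using hxy
        · rcases eq_or_ne z y with rfl | hzy
          · simpa using hxy.symm
          · rw [Equiv.swap_apply_of_ne_of_ne hzx hzy]
      · simpa using hσ.2
    · intro a _ b _ hab
      ext z
      have := congrArg (fun f : Equiv.Perm (Fin n) => (f (Equiv.swap x y z) : ℕ)) hab
      simpa using this
  calc _ = ∑ y ∈ B, ((NA A).filter (fun σ => σ x = i)).card := by simp [mul_comm]
    _ ≤ ∑ y ∈ B, ((NA A).filter (fun σ => σ y = i)).card := Finset.sum_le_sum h1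
    _ = (B.biUnion fun y => (NA A).filter (fun σ => σ y = i)).card := by
        rw [Finset.card_biUnion]
        intro y _ z _ hyz
        rw [Function.onFun, Finset.disjoint_left]
        intro σ h1 h2
        have h1 := (Finset.mem_filter.1 h1).2
        have h2 := (Finset.mem_filter.1 h2).2
        exact hyz (σ.injective (h1.trans h2.symm))
    _ ≤ _ := by
        apply Finset.card_le_card
        intro σ hσ
        simp only [Finset.mem_biUnion, Finset.mem_filter] at hσ
        obtain ⟨_, _, h, _⟩ := hσ
        exact h

theorem cover_bound {n : ℕ} (A B I Y : Finset (Fin n)) (x₀ i₀ : Fin n)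
    (hB : ∀ y ∈ B, ∀ z ∈ B, (y ∈ A ↔ z ∈ A)) (hx : x₀ ∈ B) (hY : Y ⊆ B)
    (Ev : Finset (Equiv.Perm (Fin n))) (hEv : Ev ⊆ NA A)
    (h : ∀ σ ∈ Ev, σ x₀ ∈ I ∨ ∃ y ∈ Y, σ y = i₀) :
    Ev.card * B.card ≤ (I.card + Y.card) * (NA A).card := by
  classical
  have h1 : Ev ⊆ (I.biUnion fun i => (NA A).filter (fun σ => σ x₀ = i)) ∪
      (Y.biUnion fun y => (NA A).filter (fun σ => σ y = i₀)) := by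
    intro σ hσ
    have := hEv hσ
    simp only [Finset.mem_union, Finset.mem_biUnion, Finset.mem_filter]
    rcases h σ hσ with h | ⟨y, hy, h⟩
    · exact Or.inl ⟨_, h, this, rfl⟩
    · exact Or.inr ⟨y, hy, this, h⟩
  have h2 := (Finset.card_le_card h1).trans (Finset.card_union_le _ _)
  have h3 := Nat.mul_le_mul_right B.card (h2.trans
    (Nat.add_le_add Finset.card_biUnion_le Finset.card_biUnion_le))
  refine h3.trans ?_
  rw [add_mul, add_mul, Finset.sum_mul, Finset.sum_mul]
  apply Nat.add_le_add
  · refine (Finset.sum_le_card_nsmul _ _ _ fun i _ => fiber_bound A B x₀ i ?_).trans (by simp)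
    exact fun y hy => hB y hy x₀ hx
  · refine (Finset.sum_le_card_nsmul _ _ _ fun y hy => fiber_bound A B y i₀ ?_).trans (by simp)
    exact fun z hz => hB z hz y (hY hy)

theorem down_bound {n L U : ℕ} (A D : Finset (Fin n)) (hD : D ⊂ A) (hLD : L ≤ D.card)
    (hAU : A.card ≤ U) (Ev : Finset (Equiv.Perm (Fin n))) (hEv : Ev ⊆ NA A)
    (h : ∀ σ ∈ Ev, ∃ E, L ≤ E.card ∧ σ ∈ NA E ∧ E ⊂ A ∧ (E ⊆ D ∨ D ⊆ E)) :
    Ev.card * A.card ≤ (2 * (U - L)) * (NA A).card := by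
  classical
  obtain ⟨x₀, hx₀, hx₀D⟩ := Finset.exists_of_ssubset hD
  have hcard := Finset.card_lt_card hD
  have hAn : A.card ≤ n := by simpa using A.card_le_univ
  let i₀ : Fin n := ⟨A.card - 1, by omega⟩
  let I : Finset (Fin n) := Finset.univ.filter fun i => L ≤ (i : ℕ) ∧ (i : ℕ) < A.card
  have hI : I.card ≤ U - L := by
    have : I.card ≤ (Finset.Ico L A.card).card := by
      apply Finset.card_le_card_of_injOn (fun i : Fin n => (i : ℕ))
      · intro i hi
        have := (Finset.mem_filter.1 hi).2
        simpa using this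
      · intro a _ b _ hab
        exact Fin.ext hab
    rw [Nat.card_Ico] at this
    omega
  have hY : (A \ D).card ≤ U - L := by
    rw [Finset.card_sdiff_of_subset hD.1]
    omega
  refine (cover_bound A A I (A \ D) x₀ i₀ (fun y hy z hz => by simp [hy, hz]) hx₀
    Finset.sdiff_subset Ev hEv ?_).trans (Nat.mul_le_mul_right _ (by omega))
  intro σ hσ
  have hA := mem_NA.1 (hEv hσ)
  obtain ⟨E, hLE, hE, hEA, hED | hED⟩ := h σ hσ
  · left
    have h1 := (mem_NA.1 hE x₀).not.2 (fun h => hx₀D (hED h))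
    have h2 := (hA x₀).2 hx₀
    exact Finset.mem_filter.2 ⟨Finset.mem_univ _, by omega, h2⟩
  · right
    have hc := Finset.card_lt_card hEA
    refine ⟨σ.symm i₀, ?_, by simp⟩
    have hv : ((σ (σ.symm i₀) : Fin n) : ℕ) = A.card - 1 := by simp [i₀]
    have h1 := (hA (σ.symm i₀)).1 (by omega)
    have h2 := (mem_NA.1 hE (σ.symm i₀)).not.1 (by omega)
    exact Finset.mem_sdiff.2 ⟨h1, fun h => h2 (hED h)⟩

theorem up_bound {n L U : ℕ} (A D : Finset (Fin n)) (hD : A ⊂ D) (hLD : D.card ≤ U)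
    (hAU : L ≤ A.card) (Ev : Finset (Equiv.Perm (Fin n))) (hEv : Ev ⊆ NA A)
    (h : ∀ σ ∈ Ev, ∃ E, E.card ≤ U ∧ σ ∈ NA E ∧ A ⊂ E ∧ (E ⊆ D ∨ D ⊆ E)) :
    Ev.card * (n - A.card) ≤ (2 * (U - L)) * (NA A).card := by
  classical
  obtain ⟨x₀, hx₀, hx₀D⟩ := Finset.exists_of_ssubset hD
  have hcard := Finset.card_lt_card hD
  have hDn : D.card ≤ n := by simpa using D.card_le_univ
  let i₀ : Fin n := ⟨A.card, by omega⟩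
  let I : Finset (Fin n) := Finset.univ.filter fun i => A.card ≤ (i : ℕ) ∧ (i : ℕ) < U
  have hI : I.card ≤ U - L := by
    have : I.card ≤ (Finset.Ico A.card U).card := by
      apply Finset.card_le_card_of_injOn (fun i : Fin n => (i : ℕ))
      · intro i hi
        have := (Finset.mem_filter.1 hi).2
        simpa using this
      · intro a _ b _ hab
        exact Fin.ext hab
    rw [Nat.card_Ico] at this
    omega
  have hY : (D \ A).card ≤ U - L := by
    rw [Finset.card_sdiff_of_subset hD.1]
    omega
  have hc : (Aᶜ).card = n - A.card := by simp [Finset.card_compl]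
  rw [← hc]
  refine (cover_bound A Aᶜ I (D \ A) x₀ i₀
    (fun y hy z hz => by simp [Finset.mem_compl.1 hy, Finset.mem_compl.1 hz]) (by simpa using hx₀D)
    (fun y hy => by simpa using (Finset.mem_sdiff.1 hy).2)
    Ev hEv ?_).trans (Nat.mul_le_mul_right _ (by omega))
  intro σ hσ
  have hA := mem_NA.1 (hEv hσ)
  obtain ⟨E, hLE, hE, hEA, hED | hED⟩ := h σ hσ
  · right
    have hc := Finset.card_lt_card hEA
    refine ⟨σ.symm i₀, ?_, by simp⟩
    have h1 := (hA (σ.symm i₀)).not.1 (by simp [i₀])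
    have h2 := (mem_NA.1 hE (σ.symm i₀)).1 (by simp [i₀]; omega)
    exact Finset.mem_sdiff.2 ⟨hED h2, h1⟩
  · left
    have h1 := (mem_NA.1 hE x₀).2 (hED hx₀)
    have h2 := (hA x₀).not.2 hx₀D
    exact Finset.mem_filter.2 ⟨Finset.mem_univ _, by omega, by omega⟩

/-- Either a rainbow antichain of size `s` in `G`, or a small blocking set. -/
theorem rainbow_or_block {n : ℕ} (G : Finset (Finset (Fin n))) (c : Finset (Fin n) → ℕ) (s : ℕ) :
    (∃ g : Fin s → Finset (Fin n), (∀ i, g i ∈ G) ∧ Function.Injective (c ∘ g) ∧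
      ∀ i j, g i ⊆ g j → i = j) ∨
    ∃ S ⊆ G, S.card < s ∧ ∀ E ∈ G, c E ∉ S.image c → ∃ D ∈ S, E ⊆ D ∨ D ⊆ E := by
  classical
  let Q := G.powerset.filter fun S =>
    (∀ X ∈ S, ∀ Y ∈ S, X ⊆ Y → X = Y) ∧ (∀ X ∈ S, ∀ Y ∈ S, c X = c Y → X = Y)
  have hQ : Q.Nonempty := ⟨∅, by simp [Q]⟩
  obtain ⟨S, hS, hmax⟩ := Q.exists_max_image Finset.card hQ
  have hS' := Finset.mem_filter.1 hS
  obtain ⟨hSG, hanti, hinj⟩ := hS'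
  rw [Finset.mem_powerset] at hSG
  by_cases hcard : s ≤ S.card
  · left
    obtain ⟨e⟩ : Nonempty (Fin s ↪ {x // x ∈ S}) :=
      Function.Embedding.nonempty_of_card_le (by simpa using hcard)
    refine ⟨fun i => (e i).1, fun i => hSG (e i).2, ?_, ?_⟩
    · intro i j hij
      exact e.injective (Subtype.ext (hinj _ (e i).2 _ (e j).2 hij))
    · intro i j hij
      exact e.injective (Subtype.ext (hanti _ (e i).2 _ (e j).2 hij))
  · right
    refine ⟨S, hSG, by omega, ?_⟩
    intro E hE hcE
    by_contra hno
    push Not at hno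
    have hES : E ∉ S := fun h => hcE (Finset.mem_image_of_mem c h)
    have hcE' : ∀ X ∈ S, c X ≠ c E := fun X hX h => hcE (Finset.mem_image.2 ⟨X, hX, h⟩)
    have : insert E S ∈ Q := by
      refine Finset.mem_filter.2 ⟨Finset.mem_powerset.2 (Finset.insert_subset hE hSG), ?_, ?_⟩
      · intro X hX Y hY hXY
        rcases Finset.mem_insert.1 hX with rfl | hX' <;> rcases Finset.mem_insert.1 hY with rfl | hY'
        · rfl
        · exact absurd hXY (hno Y hY').1
        · exact absurd hXY (hno X hX').2
        · exact hanti X hX' Y hY' hXY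
      · intro X hX Y hY hXY
        rcases Finset.mem_insert.1 hX with rfl | hX' <;> rcases Finset.mem_insert.1 hY with rfl | hY'
        · rfl
        · exact absurd hXY.symm (hcE' Y hY')
        · exact absurd hXY (hcE' X hX')
        · exact hinj X hX' Y hY' hXY
    have := hmax _ this
    rw [Finset.card_insert_of_notMem hES] at this
    omega

open Filter Topology in
theorem choose_ratio (j : ℕ) :
    Tendsto (fun n : ℕ => ((n.choose (n / 2 + j) : ℝ)) / (n.choose (n / 2))) atTop (𝓝 1) := by
  induction j with
  | zero =>
    refine tendsto_const_nhds.congr fun n => ?_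
    have : (0 : ℝ) < n.choose (n / 2) := by exact_mod_cast Nat.choose_pos (by omega)
    simp [this.ne']
  | succ j ih =>
    have h2 : Tendsto (fun n : ℕ => ((n - (n / 2 + j) : ℕ) : ℝ) / ((n / 2 + j + 1 : ℕ) : ℝ))
        atTop (𝓝 1) := by
      have h3 : Tendsto (fun n : ℕ => (2 * (j : ℝ) + 2) / ((n / 2 + j + 1 : ℕ) : ℝ)) atTop (𝓝 0) := by
        apply Tendsto.div_atTop tendsto_const_nhds
        apply tendsto_natCast_atTop_atTop.comp
        refine tendsto_atTop.2 fun b => ?_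
        filter_upwards [eventually_ge_atTop (2 * b)] with n hn
        omega
      have h4 : Tendsto (fun n : ℕ => ((n - (n / 2 + j) : ℕ) : ℝ) / ((n / 2 + j + 1 : ℕ) : ℝ) - 1)
          atTop (𝓝 0) := by
        apply squeeze_zero_norm' _ h3
        filter_upwards [eventually_ge_atTop (2 * j + 2)] with n hn
        have hpos : (0 : ℝ) < ((n / 2 + j + 1 : ℕ) : ℝ) := by positivity
        rw [div_sub_one hpos.ne', norm_div, Real.norm_of_nonneg hpos.le]
        gcongr
        rw [Real.norm_eq_abs, abs_le]
        have e1 : n ≤ (n - (n / 2 + j)) + (n / 2 + j) := by omega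
        have e2 : (n - (n / 2 + j)) + (2 * j + 2) ≥ (n / 2 + j + 1) := by omega
        have e3 : (n - (n / 2 + j)) ≤ (n / 2 + j + 1) + (2 * j + 2) := by omega
        have e2' : (((n - (n / 2 + j) : ℕ) : ℝ)) + (2 * j + 2) ≥ ((n / 2 + j + 1 : ℕ) : ℝ) := by
          exact_mod_cast e2
        have e3' : (((n - (n / 2 + j) : ℕ) : ℝ)) ≤ ((n / 2 + j + 1 : ℕ) : ℝ) + (2 * j + 2) := by
          exact_mod_cast e3
        constructor <;> linarith
      simpa using h4.add_const 1
    have := ih.mul h2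
    rw [one_mul] at this
    refine this.congr fun n => ?_
    have hpos : (0 : ℝ) < ((n / 2 + j + 1 : ℕ) : ℝ) := by positivity
    have hc : (0 : ℝ) < n.choose (n / 2) := by exact_mod_cast Nat.choose_pos (by omega)
    have h := Nat.choose_succ_right_eq n (n / 2 + j)
    have h' : ((n.choose (n / 2 + j + 1) : ℕ) : ℝ) * ((n / 2 + j + 1 : ℕ) : ℝ)
      = (n.choose (n / 2 + j) : ℝ) * ((n - (n / 2 + j) : ℕ) : ℝ) := by exact_mod_cast h
    rw [div_mul_div_comm, ← h', ← add_assoc, mul_div_mul_right _ _ hpos.ne']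

/-- Geometric decay step below the middle. -/
theorem choose_step {n q k : ℕ} (hq : 0 < q) (hn : 2 * q ≤ n) (hk : k + n / q < n / 2) :
    (n.choose k : ℝ) ≤ (1 - 1 / (q : ℝ)) * n.choose (k + 1) := by
  have h := Nat.choose_succ_right_eq n k
  have hkn : k ≤ n := by
    have : n / 2 ≤ n := Nat.div_le_self _ _
    have : k ≤ k + n / q := Nat.le_add_right _ _
    omega
  have h' : (n.choose (k + 1) : ℝ) * ((k : ℝ) + 1) = (n.choose k : ℝ) * ((n : ℝ) - k) := by
    rw [← Nat.cast_sub hkn]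
    exact_mod_cast h
  have hqr : (0 : ℝ) < q := by exact_mod_cast hq
  have hw : (n : ℝ) ≤ 2 * q * (n / q : ℕ) := by
    have h1 : n < q * (n / q + 1) := by
      have := Nat.lt_mul_div_succ n hq
      simpa using this
    have h2 : 2 ≤ n / q := (Nat.le_div_iff_mul_le hq).2 hn
    have : n ≤ 2 * q * (n / q) := by nlinarith
    exact_mod_cast this
  have hk' : 2 * ((k : ℝ) + 1 + (n / q : ℕ)) ≤ n := by
    have : 2 * (k + 1 + n / q) ≤ n := by omega
    exact_mod_cast this
  have hwn : (n : ℝ) / q ≤ 2 * (n / q : ℕ) := by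
    rw [div_le_iff₀ hqr]; linarith
  set w : ℝ := ((n / q : ℕ) : ℝ)
  have hw0 : 0 ≤ w := by positivity
  have hpos : (0 : ℝ) < (n : ℝ) - k := by
    have : (0 : ℝ) ≤ k := by positivity
    linarith
  have key : (k : ℝ) + 1 ≤ (1 - 1 / (q : ℝ)) * ((n : ℝ) - k) := by
    have e : (1 - 1 / (q : ℝ)) * ((n : ℝ) - k) = n - k - n / q + k / q := by ring
    have : (0 : ℝ) ≤ k / q := by positivity
    rw [e]; linarith
  have hc : (0 : ℝ) ≤ n.choose (k + 1) := by positivity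
  have := mul_le_mul_of_nonneg_left key hc
  rw [h'] at this
  have h5 : (n.choose k : ℝ) * ((n : ℝ) - k) ≤
      ((1 - 1 / (q : ℝ)) * n.choose (k + 1)) * ((n : ℝ) - k) := by linarith
  exact le_of_mul_le_mul_right h5 hpos

theorem choose_decay {n q : ℕ} (hq : 0 < q) (hn : 2 * q ≤ n) (j k : ℕ)
    (hk : k + j + n / q ≤ n / 2) :
    (n.choose k : ℝ) ≤ (1 - 1 / (q : ℝ)) ^ j * n.choose (k + j) := by
  induction j with
  | zero => simp
  | succ j ih =>
    have h0 : (0 : ℝ) ≤ 1 - 1 / (q : ℝ) := by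
      have : (1 : ℝ) ≤ q := by exact_mod_cast hq
      rw [sub_nonneg, div_le_one (by linarith)]; exact this
    refine (ih (by omega)).trans ?_
    rw [pow_succ, mul_assoc]
    exact mul_le_mul_of_nonneg_left (choose_step hq hn (by omega)) (by positivity)

theorem choose_tail {n q k : ℕ} (hq : 0 < q) (hn : 2 * q ≤ n)
    (hk : k + 2 * (n / q) < n / 2 ∨ n < k + (n / 2 - 2 * (n / q))) (hkn : k ≤ n) :
    (n.choose k : ℝ) ≤ (1 - 1 / (q : ℝ)) ^ (n / q) * n.choose (n / 2) := by
  have h0 : (0 : ℝ) ≤ 1 - 1 / (q : ℝ) := by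
    have : (1 : ℝ) ≤ q := by exact_mod_cast hq
    rw [sub_nonneg, div_le_one (by linarith)]; exact this
  have main : ∀ k, k + 2 * (n / q) < n / 2 →
      (n.choose k : ℝ) ≤ (1 - 1 / (q : ℝ)) ^ (n / q) * n.choose (n / 2) := by
    intro k hk
    refine (choose_decay hq hn (n / q) k (by omega)).trans ?_
    refine mul_le_mul_of_nonneg_left ?_ (by positivity)
    exact_mod_cast Nat.choose_le_middle _ _
  rcases hk with hk | hk
  · exact main k hk
  · rw [← Nat.choose_symm hkn]
    apply main
    omega

open Filter Topology in
theorem tail_small (q : ℕ) (h4 : 4 ≤ q) (η : ℝ) (hη : 0 < η) :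
    ∀ᶠ n : ℕ in atTop, ((n : ℝ) + 1) * (1 - 1 / (q : ℝ)) ^ (n / q) ≤ η := by
  have hq : 0 < q := by omega
  have hqr : (1 : ℝ) ≤ q := by exact_mod_cast hq
  have h0 : (0 : ℝ) ≤ 1 - 1 / (q : ℝ) := by
    rw [sub_nonneg, div_le_one (by linarith)]; exact hqr
  have h1 : 1 - 1 / (q : ℝ) < 1 := by
    have : (0 : ℝ) < 1 / q := by positivity
    linarith
  have hT := (tendsto_self_mul_const_pow_of_lt_one h0 h1).add
    (tendsto_pow_atTop_nhds_zero_of_lt_one h0 h1)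
  have hT2 := (hT.const_mul (q : ℝ)).comp (Nat.tendsto_div_const_atTop hq.ne')
  rw [add_zero, mul_zero] at hT2
  filter_upwards [hT2.eventually (ge_mem_nhds hη)] with n hn
  refine le_trans ?_ hn
  simp only [Function.comp]
  have h2 : n + 1 ≤ q * (n / q + 1) := by
    have := Nat.lt_mul_div_succ n hq
    simpa using this
  have h3 : (n : ℝ) + 1 ≤ q * ((n / q : ℕ) + 1) := by exact_mod_cast h2
  have hp : (0 : ℝ) ≤ (1 - 1 / (q : ℝ)) ^ (n / q) := by positivity
  nlinarith [mul_le_mul_of_nonneg_right h3 hp]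

theorem lower_family (n m s t : ℕ) (hs : 2 ≤ s) (ht : 2 ≤ t) :
    AvoidsRainbow n (AC s ⊕ₗ AC t)
      (Finset.univ.filter fun A : Finset (Fin n) => A.card ∈ Finset.Ico m (m + (s + t))) := by
  classical
  refine ⟨Finset.card, ?_, ?_⟩
  · intro A _ B _ hne hsub
    exact (Finset.card_lt_card (hsub.ssubset_of_ne hne)).ne
  rintro ⟨f, ⟨hmem, hinj, hle⟩, hrain⟩
  let B : Fin s → Finset (Fin n) := fun i => f (Sum.inlₗ (show AC s from i))
  let T : Fin t → Finset (Fin n) := fun j => f (Sum.inrₗ (show AC t from j))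
  have hBT : ∀ i j, B i ⊆ T j := fun i j => (hle _ _).2 (Sum.Lex.inl_le_inr _ _)
  have hBB : ∀ i j, B i ⊆ B j → i = j := fun i j h => by
    have := (hle _ _).1 h
    exact Sum.Lex.inl_le_inl_iff.1 this
  have hTT : ∀ i j, T i ⊆ T j → i = j := fun i j h => by
    have := (hle _ _).1 h
    exact Sum.Lex.inr_le_inr_iff.1 this
  let h : Fin s ⊕ Fin t → ℕ := fun x => (f (toLex (show AC s ⊕ AC t from x))).card
  have hh : Function.Injective h := hrain
  have himg : Finset.univ.image h = Finset.Ico m (m + (s + t)) := by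
    apply Finset.eq_of_subset_of_card_le
    · intro v hv
      obtain ⟨x, _, rfl⟩ := Finset.mem_image.1 hv
      exact (Finset.mem_filter.1 (hmem _)).2
    · rw [Finset.card_image_of_injective _ hh]; simp
  have : Nontrivial (Fin s) := Fin.nontrivial_iff_two_le.2 hs
  have : Nontrivial (Fin t) := Fin.nontrivial_iff_two_le.2 ht
  obtain ⟨i, hi⟩ := Finite.exists_max (fun i => (B i).card)
  obtain ⟨j, hj⟩ := Finite.exists_min (fun j => (T j).card)
  obtain ⟨i', hi'⟩ := exists_ne i
  obtain ⟨j', hj'⟩ := exists_ne j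
  have h1 : (B i).card < (B i ∪ B i').card := by
    apply Finset.card_lt_card
    refine ⟨Finset.subset_union_left, fun h => hi' (hBB _ _ ?_)⟩
    exact Finset.subset_union_right.trans h
  have h2 : (T j ∩ T j').card < (T j).card := by
    apply Finset.card_lt_card
    refine ⟨Finset.inter_subset_left, fun h => hj' (hTT _ _ ?_).symm⟩
    exact h.trans Finset.inter_subset_right
  have h3 : (B i ∪ B i').card ≤ (T j ∩ T j').card := by
    apply Finset.card_le_card
    exact Finset.union_subset (Finset.subset_inter (hBT _ _) (hBT _ _))
      (Finset.subset_inter (hBT _ _) (hBT _ _))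
  have hb : (B i).card ∈ Finset.Ico m (m + (s + t)) := (Finset.mem_filter.1 (hmem _)).2
  have ht' : (T j).card ∈ Finset.Ico m (m + (s + t)) := (Finset.mem_filter.1 (hmem _)).2
  rw [Finset.mem_Ico] at hb ht'
  have h4 : (B i).card + 1 ∈ Finset.univ.image h := by
    rw [himg, Finset.mem_Ico]; omega
  obtain ⟨x, _, hx⟩ := Finset.mem_image.1 h4
  rcases x with x | x
  · have h5 : (B x).card = (B i).card + 1 := hx
    have := hi x
    omega
  · have h5 : (T x).card = (B i).card + 1 := hx
    have := hj x
    omega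

theorem card_levels (n : ℕ) (J : Finset ℕ) :
    (Finset.univ.filter fun A : Finset (Fin n) => A.card ∈ J).card = ∑ k ∈ J, n.choose k := by
  classical
  have hm : ∀ A ∈ (Finset.univ.filter fun A : Finset (Fin n) => A.card ∈ J), A.card ∈ J :=
    fun A hA => (Finset.mem_filter.1 hA).2
  rw [Finset.card_eq_sum_card_fiberwise hm]
  refine Finset.sum_congr rfl fun k hk => ?_
  have : (Finset.univ.filter fun A : Finset (Fin n) => A.card ∈ J).filter (fun A => A.card = k)
      = Finset.univ.powersetCard k := by
    ext A
    simp only [Finset.mem_filter, Finset.mem_univ, true_and, Finset.mem_powersetCard,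
      Finset.subset_univ]
    constructor
    · exact fun h => h.2
    · rintro rfl; exact ⟨hk, rfl⟩
  rw [this]; simp

theorem le_LaR {n : ℕ} {P : Type*} [PartialOrder P] {𝓕 : Finset (Finset (Fin n))}
    (h : AvoidsRainbow n P 𝓕) : 𝓕.card ≤ LaR n P := by
  apply le_csSup
  · refine ⟨(Finset.univ : Finset (Finset (Fin n))).card, ?_⟩
    rintro m ⟨𝓖, rfl, _⟩
    exact Finset.card_le_card (Finset.subset_univ _)
  · exact ⟨𝓕, rfl, h⟩

open Filter Topology in
theorem lower_bound (s t : ℕ) (hs : 2 ≤ s) (ht : 2 ≤ t) (ε : ℝ) (hε : 0 < ε) :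
    ∀ᶠ n : ℕ in atTop,
      ((s : ℝ) + t - ε) * (n.choose (n / 2)) ≤ (LaR n (AC s ⊕ₗ AC t) : ℝ) := by
  have hT : Tendsto (fun n : ℕ => ∑ j ∈ Finset.range (s + t),
      ((n.choose (n / 2 + j) : ℝ)) / (n.choose (n / 2))) atTop
      (𝓝 (∑ j ∈ Finset.range (s + t), 1)) := tendsto_finsetSum _ fun j _ => choose_ratio j
  have hlt : (s : ℝ) + t - ε < ∑ j ∈ Finset.range (s + t), (1 : ℝ) := by simp [hε]
  filter_upwards [hT.eventually (le_mem_nhds hlt)] with n hn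
  have hc : (0 : ℝ) < n.choose (n / 2) := by exact_mod_cast Nat.choose_pos (by omega)
  rw [← Finset.sum_div, le_div_iff₀ hc] at hn
  refine hn.trans ?_
  have h1 := le_LaR (lower_family n (n / 2) s t hs ht)
  rw [card_levels, Finset.sum_Ico_eq_sum_range, Nat.add_sub_cancel_left] at h1
  exact_mod_cast h1

theorem exists_new_color {n s : ℕ} {F S K : Finset (Finset (Fin n))} {c : Finset (Fin n) → ℕ}
    (hc : FamilyProperColoring n F c) (σ : Equiv.Perm (Fin n))
    (hK : ∀ E ∈ K, E ∈ F ∧ σ ∈ NA E) (hS : S.card < s) (hs : s ≤ K.card) :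
    ∃ E ∈ K, c E ∉ S.image c := by
  classical
  have hinj : Set.InjOn c K := by
    intro X hX Y hY hXY
    by_contra hne
    have hX := hK X hX
    have hY := hK Y hY
    rcases le_total X.card Y.card with h | h
    · exact hc X hX.1 Y hY.1 hne (NA_subset_of_card hX.2 hY.2 h) hXY
    · exact hc Y hY.1 X hX.1 (Ne.symm hne) (NA_subset_of_card hY.2 hX.2 h) hXY.symm
  have h1 : (S.image c).card < (K.image c).card := by
    rw [Finset.card_image_of_injOn hinj]
    exact lt_of_le_of_lt Finset.card_image_le (by omega)
  obtain ⟨v, hv, hvS⟩ := Finset.exists_mem_notMem_of_card_lt_card h1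
  obtain ⟨E, hE, rfl⟩ := Finset.mem_image.1 hv
  exact ⟨E, hE, hvS⟩

theorem union_bound {n a M s : ℕ} (S : Finset (Finset (Fin n)))
    (Ev : Finset (Equiv.Perm (Fin n))) (R : Finset (Fin n) → Equiv.Perm (Fin n) → Prop)
    (h : ∀ σ ∈ Ev, ∃ D ∈ S, R D σ) (hS : S.card < s)
    (hb : ∀ D ∈ S, ∀ Ev' ⊆ Ev, (∀ σ ∈ Ev', R D σ) → Ev'.card * a ≤ M) :
    Ev.card * a ≤ s * M := by
  classical
  have h1 : Ev ⊆ S.biUnion fun D => Ev.filter (R D) := by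
    intro σ hσ
    obtain ⟨D, hD, hR⟩ := h σ hσ
    exact Finset.mem_biUnion.2 ⟨D, hD, Finset.mem_filter.2 ⟨hσ, hR⟩⟩
  have h2 := Nat.mul_le_mul_right a ((Finset.card_le_card h1).trans Finset.card_biUnion_le)
  refine h2.trans ?_
  rw [Finset.sum_mul]
  refine (Finset.sum_le_card_nsmul _ _ M fun D hD => ?_).trans ?_
  · exact hb D hD _ (Finset.filter_subset _ _) fun σ hσ => (Finset.mem_filter.1 hσ).2
  · rw [smul_eq_mul]
    exact Nat.mul_le_mul_right _ hS.le

open Classical in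
theorem bad_bound {n s t L U : ℕ} {F : Finset (Finset (Fin n))} {c : Finset (Fin n) → ℕ}
    (hc : FamilyProperColoring n F c)
    (hno : ¬∃ f : AC s ⊕ₗ AC t → Finset (Fin n), FamilyCopy n F (AC s ⊕ₗ AC t) f ∧
      Function.Injective (c ∘ f))
    (hL : ∀ A ∈ F, L ≤ A.card) (hU : ∀ A ∈ F, A.card ≤ U) (hLU : U + L ≤ n)
    (A : Finset (Fin n)) (hA : A ∈ F) :
    ((NA A).filter fun σ => s ≤ (F.filter fun E => σ ∈ NA E ∧ E ⊂ A).card ∧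
      t ≤ (F.filter fun E => σ ∈ NA E ∧ A ⊂ E).card).card * L ≤
      (s + t) * (2 * (U - L) * (NA A).card) := by
  set Ev := (NA A).filter fun σ => s ≤ (F.filter fun E => σ ∈ NA E ∧ E ⊂ A).card ∧
      t ≤ (F.filter fun E => σ ∈ NA E ∧ A ⊂ E).card with hEv
  have hEvA : Ev ⊆ NA A := Finset.filter_subset _ _
  rcases rainbow_or_block (F.filter fun E => E ⊂ A) c s with ⟨g, hg, hgc, hga⟩ | ⟨S, hSG, hS, hblock⟩
  · rcases rainbow_or_block (F.filter fun E => A ⊂ E) c t with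
      ⟨g', hg', hgc', hga'⟩ | ⟨S, hSG, hS, hblock⟩
    · exfalso
      apply hno
      simp only [Finset.mem_filter] at hg hg'
      have hlt : ∀ i j, g i ⊂ g' j := fun i j => (hg i).2.trans (hg' j).2
      have hcne : ∀ i j, c (g i) ≠ c (g' j) := fun i j =>
        hc _ (hg i).1 _ (hg' j).1 (hlt i j).ne (hlt i j).1
      let f : AC s ⊕ₗ AC t → Finset (Fin n) := fun x => Sum.elim g g' (ofLex x)
      have hf : Function.Injective (c ∘ f) := by
        intro x y hxy
        rcases x with x | x <;> rcases y with y | y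
        · exact congrArg Sum.inl (hgc hxy)
        · exact absurd hxy (hcne _ _)
        · exact absurd hxy.symm (hcne _ _)
        · exact congrArg Sum.inr (hgc' hxy)
      refine ⟨f, ⟨?_, hf.of_comp, ?_⟩, hf⟩
      · intro x
        rcases x with x | x
        · exact (hg x).1
        · exact (hg' x).1
      · intro x y
        rcases x with x | x <;> rcases y with y | y
        · refine Iff.trans ?_ (Sum.Lex.inl_le_inl_iff (a := x) (b := y)).symm
          exact ⟨fun h => hga _ _ h, fun h => by cases h; exact subset_rfl⟩
        · exact ⟨fun _ => Sum.Lex.inl_le_inr x y, fun _ => (hlt _ _).1⟩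
        · exact ⟨fun h => absurd h (hlt _ _).2, fun h => absurd h Sum.Lex.not_inr_le_inl⟩
        · refine Iff.trans ?_ (Sum.Lex.inr_le_inr_iff (a := x) (b := y)).symm
          exact ⟨fun h => hga' _ _ h, fun h => by cases h; exact subset_rfl⟩
    · have key : Ev.card * (n - A.card) ≤ t * (2 * (U - L) * (NA A).card) := by
        apply union_bound S Ev
          (fun D σ => ∃ E, E.card ≤ U ∧ σ ∈ NA E ∧ A ⊂ E ∧ (E ⊆ D ∨ D ⊆ E)) _ hS
        · intro D hD Ev' hEv' hR
          have hDF := Finset.mem_filter.1 (hSG hD)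
          exact up_bound A D hDF.2 (hU D hDF.1) (hL A hA) Ev' (hEv'.trans hEvA) hR
        · intro σ hσ
          have hσ := (Finset.mem_filter.1 hσ).2.2
          obtain ⟨E, hE, hcE⟩ := exists_new_color hc σ
            (fun E hE => ⟨(Finset.mem_filter.1 hE).1, (Finset.mem_filter.1 hE).2.1⟩) hS hσ
          have hE := Finset.mem_filter.1 hE
          obtain ⟨D, hD, hDE⟩ := hblock E (Finset.mem_filter.2 ⟨hE.1, hE.2.2⟩) hcE
          exact ⟨D, hD, E, hU E hE.1, hE.2.1, hE.2.2, hDE⟩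
      have h1 : L ≤ n - A.card := by have := hU A hA; omega
      exact (Nat.mul_le_mul_left _ h1).trans (key.trans (Nat.mul_le_mul_right _ (by omega)))
  · have key : Ev.card * A.card ≤ s * (2 * (U - L) * (NA A).card) := by
      apply union_bound S Ev
        (fun D σ => ∃ E, L ≤ E.card ∧ σ ∈ NA E ∧ E ⊂ A ∧ (E ⊆ D ∨ D ⊆ E)) _ hS
      · intro D hD Ev' hEv' hR
        have hDF := Finset.mem_filter.1 (hSG hD)
        exact down_bound A D hDF.2 (hL D hDF.1) (hU A hA) Ev' (hEv'.trans hEvA) hR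
      · intro σ hσ
        have hσ := (Finset.mem_filter.1 hσ).2.1
        obtain ⟨E, hE, hcE⟩ := exists_new_color hc σ
          (fun E hE => ⟨(Finset.mem_filter.1 hE).1, (Finset.mem_filter.1 hE).2.1⟩) hS hσ
        have hE := Finset.mem_filter.1 hE
        obtain ⟨D, hD, hDE⟩ := hblock E (Finset.mem_filter.2 ⟨hE.1, hE.2.2⟩) hcE
        exact ⟨D, hD, E, hL E hE.1, hE.2.1, hE.2.2, hDE⟩
    exact (Nat.mul_le_mul_left _ (hL A hA)).trans (key.trans (Nat.mul_le_mul_right _ (by omega)))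

open Classical in
theorem chain_count {n s t : ℕ} (F : Finset (Finset (Fin n))) (σ : Equiv.Perm (Fin n)) :
    (F.filter fun A => σ ∈ NA A).card ≤ s + t +
      (F.filter fun A => σ ∈ NA A ∧ s ≤ (F.filter fun E => σ ∈ NA E ∧ E ⊂ A).card ∧
      t ≤ (F.filter fun E => σ ∈ NA E ∧ A ⊂ E).card).card := by
  let lo : Finset (Fin n) → ℕ := fun A => (F.filter fun E => σ ∈ NA E ∧ E ⊂ A).card
  let hi : Finset (Fin n) → ℕ := fun A => (F.filter fun E => σ ∈ NA E ∧ A ⊂ E).card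
  have hcomp : ∀ A B, σ ∈ NA A → σ ∈ NA B → A ≠ B → A ⊂ B ∨ B ⊂ A := by
    intro A B hA hB hne
    rcases le_total A.card B.card with h | h
    · exact Or.inl ((NA_subset_of_card hA hB h).ssubset_of_ne hne)
    · exact Or.inr ((NA_subset_of_card hB hA h).ssubset_of_ne hne.symm)
  have hlo : ∀ A B, A ∈ F → σ ∈ NA A → A ⊂ B → lo A < lo B := by
    intro A B hAF hA hAB
    apply Finset.card_lt_card
    refine (Finset.ssubset_iff_of_subset ?_).2 ⟨A, ?_, ?_⟩
    · intro E hE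
      have hE := Finset.mem_filter.1 hE
      exact Finset.mem_filter.2 ⟨hE.1, hE.2.1, hE.2.2.trans hAB⟩
    · exact Finset.mem_filter.2 ⟨hAF, hA, hAB⟩
    · intro h
      exact (Finset.mem_filter.1 h).2.2.ne rfl
  have hhi : ∀ A B, B ∈ F → σ ∈ NA B → A ⊂ B → hi B < hi A := by
    intro A B hBF hB hAB
    apply Finset.card_lt_card
    refine (Finset.ssubset_iff_of_subset ?_).2 ⟨B, ?_, ?_⟩
    · intro E hE
      have hE := Finset.mem_filter.1 hE
      exact Finset.mem_filter.2 ⟨hE.1, hE.2.1, hAB.trans hE.2.2⟩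
    · exact Finset.mem_filter.2 ⟨hBF, hB, hAB⟩
    · intro h
      exact (Finset.mem_filter.1 h).2.2.ne rfl
  have h1 : (F.filter fun A => σ ∈ NA A ∧ lo A < s).card ≤ s := by
    rw [← Finset.card_range s]
    apply Finset.card_le_card_of_injOn lo
    · intro A hA
      have hA := Finset.mem_filter.1 hA
      simpa using hA.2.2
    · intro A hA B hB hAB
      have hA := Finset.mem_filter.1 hA
      have hB := Finset.mem_filter.1 hB
      by_contra hne
      rcases hcomp A B hA.2.1 hB.2.1 hne with h | h
      · exact (hlo A B hA.1 hA.2.1 h).ne hAB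
      · exact (hlo B A hB.1 hB.2.1 h).ne hAB.symm
  have h2 : (F.filter fun A => σ ∈ NA A ∧ hi A < t).card ≤ t := by
    rw [← Finset.card_range t]
    apply Finset.card_le_card_of_injOn hi
    · intro A hA
      have hA := Finset.mem_filter.1 hA
      simpa using hA.2.2
    · intro A hA B hB hAB
      have hA := Finset.mem_filter.1 hA
      have hB := Finset.mem_filter.1 hB
      by_contra hne
      rcases hcomp A B hA.2.1 hB.2.1 hne with h | h
      · exact (hhi A B hB.1 hB.2.1 h).ne hAB.symm
      · exact (hhi B A hA.1 hA.2.1 h).ne hAB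
  have h3 : (F.filter fun A => σ ∈ NA A) ⊆ ((F.filter fun A => σ ∈ NA A ∧ lo A < s) ∪
      (F.filter fun A => σ ∈ NA A ∧ hi A < t)) ∪
      (F.filter fun A => σ ∈ NA A ∧ s ≤ lo A ∧ t ≤ hi A) := by
    intro A hA
    have hA := Finset.mem_filter.1 hA
    simp only [Finset.mem_union, Finset.mem_filter, hA.1, hA.2, true_and]
    omega
  have h4 := (Finset.card_le_card h3).trans ((Finset.card_union_le _ _).trans
    (Nat.add_le_add_right (Finset.card_union_le _ _) _))
  refine h4.trans ?_
  exact Nat.add_le_add_right (Nat.add_le_add h1 h2) _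

theorem double_count {n : ℕ} (F : Finset (Finset (Fin n)))
    (R : Finset (Fin n) → Equiv.Perm (Fin n) → Prop) [∀ A, DecidablePred (R A)] :
    ∑ A ∈ F, ((NA A).filter (R A)).card =
      ∑ σ : Equiv.Perm (Fin n), (F.filter fun A => σ ∈ NA A ∧ R A σ).card := by
  have h := Finset.sum_card_bipartiteAbove_eq_sum_card_bipartiteBelow
    (s := F) (t := (Finset.univ : Finset (Equiv.Perm (Fin n)))) (fun A σ => σ ∈ NA A ∧ R A σ)
  refine Eq.trans (Finset.sum_congr rfl fun A _ => ?_) h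
  congr 1
  ext σ
  simp [Finset.bipartiteAbove]

theorem numeric_bound (r ε q n L d T fac C N : ℝ) (hr0 : 0 < r) (hε : 0 < ε) (hq0 : 0 < q)
    (hqr : 40 * r * (r + ε / 2) ≤ (ε / 2) * q)
    (hfac : 0 < fac) (hL4 : n ≤ 4 * L) (hn0 : 0 < n) (hUL : q * d ≤ 5 * n)
    (hwin' : T * L ≤ r * fac * L + r * (2 * d) * T) (hcard' : N * fac ≤ C * T) (hT0 : 0 ≤ T)
    (hC : 0 < C) : N ≤ (r + ε / 2) * C := by
  have hL0 : 0 < L := by linarith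
  have hd : r * (2 * d) * (r + ε / 2) ≤ (ε / 2) * L := by
    have h1 : q * (r * (2 * d) * (r + ε / 2)) ≤ q * ((ε / 2) * L) := by
      calc q * (r * (2 * d) * (r + ε / 2))
          = (2 * r * (r + ε / 2)) * (q * d) := by ring
        _ ≤ (2 * r * (r + ε / 2)) * (5 * (4 * L)) := by
            apply mul_le_mul_of_nonneg_left _ (by positivity)
            linarith
        _ = (40 * r * (r + ε / 2)) * L := by ring
        _ ≤ ((ε / 2) * q) * L := mul_le_mul_of_nonneg_right hqr hL0.le
        _ = _ := by ring
    exact le_of_mul_le_mul_left h1 hq0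
  have hTb : T ≤ (r + ε / 2) * fac := by
    have h1 := mul_le_mul_of_nonneg_right hd hT0
    have h2 := mul_le_mul_of_nonneg_left hwin' (by positivity : 0 ≤ r + ε / 2)
    have h3 : (r * L) * T ≤ (r * L) * ((r + ε / 2) * fac) := by linarith
    exact le_of_mul_le_mul_left h3 (by positivity)
  have h5 : N * fac ≤ ((r + ε / 2) * C) * fac := by
    refine hcard'.trans ((mul_le_mul_of_nonneg_left hTb hC.le).trans (le_of_eq (by ring)))
  exact le_of_mul_le_mul_right h5 hfac

theorem window_bound {n s t L U : ℕ} {F : Finset (Finset (Fin n))} {c : Finset (Fin n) → ℕ}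
    (hc : FamilyProperColoring n F c)
    (hno : ¬∃ f : AC s ⊕ₗ AC t → Finset (Fin n), FamilyCopy n F (AC s ⊕ₗ AC t) f ∧
      Function.Injective (c ∘ f))
    (hL : ∀ A ∈ F, L ≤ A.card) (hU : ∀ A ∈ F, A.card ≤ U) (hLU : U + L ≤ n) :
    (∑ A ∈ F, (NA A).card) * L ≤ (s + t) * n.factorial * L +
      (s + t) * (2 * (U - L)) * ∑ A ∈ F, (NA A).card := by
  classical
  have e1 : ∑ A ∈ F, (NA A).card =
      ∑ σ : Equiv.Perm (Fin n), (F.filter fun A => σ ∈ NA A).card := by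
    simpa using double_count F (fun _ _ => True)
  have e2 := double_count F (fun A σ => s ≤ (F.filter fun E => σ ∈ NA E ∧ E ⊂ A).card ∧
      t ≤ (F.filter fun E => σ ∈ NA E ∧ A ⊂ E).card)
  have h1 : ∑ A ∈ F, (NA A).card ≤ (s + t) * n.factorial +
      ∑ A ∈ F, ((NA A).filter fun σ => s ≤ (F.filter fun E => σ ∈ NA E ∧ E ⊂ A).card ∧
      t ≤ (F.filter fun E => σ ∈ NA E ∧ A ⊂ E).card).card := by
    rw [e1, e2]
    refine (Finset.sum_le_sum fun σ _ => chain_count (s := s) (t := t) F σ).trans ?_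
    rw [Finset.sum_add_distrib]
    simp [Fintype.card_perm, mul_comm]
  have h2 := Nat.mul_le_mul_right L h1
  refine h2.trans ?_
  rw [add_mul]
  apply Nat.add_le_add_left
  rw [Finset.sum_mul, Finset.mul_sum]
  refine Finset.sum_le_sum fun A hA => ?_
  refine (bad_bound hc hno hL hU hLU A hA).trans (le_of_eq (by ring))

theorem card_mul_fact_le {n : ℕ} (F : Finset (Finset (Fin n))) :
    F.card * n.factorial ≤ n.choose (n / 2) * ∑ A ∈ F, (NA A).card := by
  rw [Finset.mul_sum, ← smul_eq_mul]
  refine Finset.card_nsmul_le_sum _ _ _ fun A _ => ?_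
  rw [← choose_mul_NA A]
  exact Nat.mul_le_mul_right _ (Nat.choose_le_middle _ _)

open Filter Topology in
theorem upper_bound (s t : ℕ) (hs : 2 ≤ s) (ht : 2 ≤ t) (ε : ℝ) (hε : 0 < ε) :
    ∀ᶠ n : ℕ in atTop,
      (LaR n (AC s ⊕ₗ AC t) : ℝ) ≤ ((s : ℝ) + t + ε) * (n.choose (n / 2)) := by
  classical
  have hs' : (0 : ℝ) < s := by exact_mod_cast (by omega : 0 < s)
  have ht' : (0 : ℝ) < t := by exact_mod_cast (by omega : 0 < t)
  set r : ℝ := (s : ℝ) + t with hr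
  have hr0 : 0 < r := by positivity
  obtain ⟨q₀, hq₀⟩ := exists_nat_ge (40 * r * (r + ε / 2) / (ε / 2))
  set q := q₀ + 16 with hq
  have hqr : 40 * r * (r + ε / 2) ≤ (ε / 2) * q := by
    rw [div_le_iff₀ (by positivity)] at hq₀
    have : (q : ℝ) = q₀ + 16 := by simp [hq]
    rw [this]
    nlinarith
  have hq16 : (16 : ℕ) ≤ q := by omega
  filter_upwards [tail_small q (by omega) (ε / 2) (by positivity),
    eventually_ge_atTop (2 * q)] with n htail hn
  have hC : (0 : ℝ) < n.choose (n / 2) := by exact_mod_cast Nat.choose_pos (by omega)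
  set w := n / q with hw
  have hwn : q * w ≤ n := Nat.mul_div_le n q
  have h16w : 16 * w ≤ n := le_trans (Nat.mul_le_mul_right _ hq16) hwn
  set L := n / 2 - 2 * w with hLdef
  set U := n - L with hUdef
  suffices H : ∀ 𝓕 : Finset (Finset (Fin n)), AvoidsRainbow n (AC s ⊕ₗ AC t) 𝓕 →
      (𝓕.card : ℝ) ≤ (r + ε) * (n.choose (n / 2)) by
    have h1 : LaR n (AC s ⊕ₗ AC t) ≤ ⌊(r + ε) * (n.choose (n / 2))⌋₊ := by
      apply csSup_le'
      rintro m ⟨𝓕, rfl, h𝓕⟩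
      exact Nat.le_floor (H 𝓕 h𝓕)
    exact (Nat.cast_le.2 h1).trans (Nat.floor_le (by positivity))
  rintro 𝓕 ⟨c, hc, hno⟩
  set F := 𝓕.filter fun A => L ≤ A.card ∧ A.card ≤ U with hF
  have hFs : F ⊆ 𝓕 := Finset.filter_subset _ _
  have hcF : FamilyProperColoring n F c := fun A hA B hB => hc A (hFs hA) B (hFs hB)
  have hnoF : ¬∃ f : AC s ⊕ₗ AC t → Finset (Fin n), FamilyCopy n F (AC s ⊕ₗ AC t) f ∧
      Function.Injective (c ∘ f) := by
    rintro ⟨f, ⟨h1, h2⟩, h3⟩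
    exact hno ⟨f, ⟨fun p => hFs (h1 p), h2⟩, h3⟩
  have hwin := window_bound (L := L) (U := U) hcF hnoF
    (fun A hA => (Finset.mem_filter.1 hA).2.1) (fun A hA => (Finset.mem_filter.1 hA).2.2) (by omega)
  have hcard := card_mul_fact_le F
  set T := ∑ A ∈ F, (NA A).card with hT
  clear_value T
  -- window part
  have hFb : (F.card : ℝ) ≤ (r + ε / 2) * n.choose (n / 2) := by
    have hfac : (0 : ℝ) < n.factorial := by exact_mod_cast n.factorial_pos
    have hL4 : (n : ℝ) ≤ 4 * L := by exact_mod_cast (by omega : n ≤ 4 * L)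
    have hn0 : (0 : ℝ) < n := by exact_mod_cast (by omega : 0 < n)
    have hUL : (q : ℝ) * (U - L : ℕ) ≤ 5 * n := by
      have h1 : U - L ≤ 4 * w + 1 := by omega
      have h2 : q * (U - L) ≤ 5 * n :=
        calc q * (U - L) ≤ q * (4 * w + 1) := Nat.mul_le_mul_left _ h1
          _ = 4 * (q * w) + q := by ring
          _ ≤ 5 * n := by omega
      exact_mod_cast h2
    have hwin' : (T : ℝ) * L ≤ r * n.factorial * L + r * (2 * (U - L : ℕ)) * T := by
      have := (Nat.cast_le (α := ℝ)).2 hwin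
      rw [hr]
      simpa only [Nat.cast_mul, Nat.cast_add, Nat.cast_ofNat] using this
    have hcard' : (F.card : ℝ) * n.factorial ≤ n.choose (n / 2) * T := by exact_mod_cast hcard
    have hT0 : (0 : ℝ) ≤ T := by positivity
    have hq0 : (0 : ℝ) < q := by exact_mod_cast (by omega : 0 < q)
    exact numeric_bound r ε q n L ((U - L : ℕ) : ℝ) T n.factorial (n.choose (n / 2)) F.card
      hr0 hε hq0 hqr hfac hL4 hn0 hUL hwin' hcard' hT0 hC
  -- tail part
  have hout : ((𝓕.filter fun A => ¬ (L ≤ A.card ∧ A.card ≤ U)).card : ℝ) ≤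
      (ε / 2) * n.choose (n / 2) := by
    let J := (Finset.range (n + 1)).filter fun k => ¬ (L ≤ k ∧ k ≤ U)
    have h1 : (𝓕.filter fun A => ¬ (L ≤ A.card ∧ A.card ≤ U)).card ≤ ∑ k ∈ J, n.choose k := by
      rw [← card_levels]
      apply Finset.card_le_card
      intro A hA
      have hA := (Finset.mem_filter.1 hA).2
      have hAn : A.card ≤ n := by simpa using A.card_le_univ
      refine Finset.mem_filter.2 ⟨Finset.mem_univ _, Finset.mem_filter.2 ⟨?_, hA⟩⟩
      rw [Finset.mem_range]; omega
    have h2 : ∑ k ∈ J, (n.choose k : ℝ) ≤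
        ∑ k ∈ J, (1 - 1 / (q : ℝ)) ^ w * n.choose (n / 2) := by
      refine Finset.sum_le_sum fun k hk => ?_
      have hk := Finset.mem_filter.1 hk
      have hk1 := Finset.mem_range.1 hk.1
      have hk2 := hk.2
      apply choose_tail (by omega) hn _ (by omega)
      rw [← hw]
      omega
    have h3 : ((𝓕.filter fun A => ¬ (L ≤ A.card ∧ A.card ≤ U)).card : ℝ) ≤
        ∑ k ∈ J, (n.choose k : ℝ) := by exact_mod_cast h1
    refine h3.trans (h2.trans ?_)
    rw [Finset.sum_const, nsmul_eq_mul, ← mul_assoc]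
    apply mul_le_mul_of_nonneg_right _ hC.le
    refine le_trans (mul_le_mul_of_nonneg_right ?_ ?_) htail
    · have : J.card ≤ n + 1 := by
        exact (Finset.card_filter_le _ _).trans (by simp)
      exact_mod_cast this
    · have : (1 : ℝ) ≤ q := by exact_mod_cast (by omega : 1 ≤ q)
      have h0 : (0 : ℝ) ≤ 1 - 1 / (q : ℝ) := by
        rw [sub_nonneg, div_le_one (by linarith)]; exact this
      positivity
  have hsum := Finset.card_filter_add_card_filter_not (s := 𝓕)
    (fun A : Finset (Fin n) => L ≤ A.card ∧ A.card ≤ U)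
  have hsum' : (F.card : ℝ) + ((𝓕.filter fun A => ¬ (L ≤ A.card ∧ A.card ≤ U)).card : ℝ) =
      𝓕.card := by exact_mod_cast hsum
  linarith


/-- For all `s, t ≥ 2` and `ε > 0` there exists `n₀` such that for all
`n ≥ n₀`, `(s + t - ε) · C(n, ⌊n/2⌋) ≤ La_R^*(n, K_{s,t}) ≤ (s + t + ε) · C(n, ⌊n/2⌋)`,
where `K_{s,t}` is the complete bipartite poset `A_s ⊕ₗ A_t`. -/
theorem statement16 (s t : ℕ) (hs : 2 ≤ s) (ht : 2 ≤ t) (ε : ℝ) (hε : 0 < ε) :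
    ∃ n₀ : ℕ, ∀ n, n₀ ≤ n →
      ((s : ℝ) + t - ε) * (n.choose (n / 2)) ≤ (LaR n (AC s ⊕ₗ AC t) : ℝ) ∧
      (LaR n (AC s ⊕ₗ AC t) : ℝ) ≤ ((s : ℝ) + t + ε) * (n.choose (n / 2)) := by
  obtain ⟨n₀, h⟩ := Filter.eventually_atTop.1
    ((lower_bound s t hs ht ε hε).and (upper_bound s t hs ht ε hε))
  exact ⟨n₀, h⟩
end

section
/- For every ε > 0 there exists n₀ such that for all n ≥ n₀, (3 − ε) · C(n, ⌊n/2⌋) ≤ La_R*(n,◊) ≤ (19/6 + ε) · C(n, ⌊n/2⌋), where ◊ is the diamond poset. -/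
/-- The order relation of the diamond: `0` is minimum, `3` is maximum, `1, 2` incomparable. -/
def DiamondRel (x y : Fin 4) : Prop :=
  x.val = y.val ∨ (x.val = 0 ∧ y.val ≠ 0) ∨ (y.val = 3 ∧ x.val ≠ 3)

instance : DecidableRel DiamondRel := fun x y => by unfold DiamondRel; infer_instance

/-- The diamond poset `◊`: a minimum element `0`, a maximum element `3`, and two
incomparable middle elements `1, 2`. -/
def Diamond := Fin 4

instance : DecidableEq Diamond := instDecidableEqFin 4
instance : Fintype Diamond := Fin.fintype 4

instance : PartialOrder Diamond where
  le := DiamondRel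
  le_refl _ := Or.inl rfl
  le_trans := by show ∀ a b c : Fin 4, DiamondRel a b → DiamondRel b c → DiamondRel a c; decide
  le_antisymm := by show ∀ a b : Fin 4, DiamondRel a b → DiamondRel b a → a = b; decide

open Finset

namespace RD

lemma choose_mul_le (w m s : ℕ) (hs : 1 ≤ s) (hw : w ≤ m) :
    w.choose s * m ≤ w * m.choose s := by
  rcases Nat.eq_zero_or_pos w with h0 | hw0
  · subst h0
    rw [Nat.choose_eq_zero_of_lt hs]; simp
  obtain ⟨w, rfl⟩ : ∃ w', w = w' + 1 := ⟨w - 1, by omega⟩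
  obtain ⟨m, rfl⟩ : ∃ w', m = w' + 1 := ⟨m - 1, by omega⟩
  obtain ⟨s, rfl⟩ : ∃ w', s = w' + 1 := ⟨s - 1, by omega⟩
  have h1 := Nat.add_one_mul_choose_eq w s
  have h2 := Nat.add_one_mul_choose_eq m s
  have h3 : w.choose s ≤ m.choose s := Nat.choose_le_choose s (by omega)
  refine Nat.le_of_mul_le_mul_right (c := s + 1) ?_ (by omega)
  calc (w+1).choose (s+1) * (m+1) * (s+1) = ((w+1).choose (s+1) * (s+1)) * (m+1) := by ring
    _ = (w+1) * w.choose s * (m+1) := by rw [h1]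
    _ ≤ (w+1) * m.choose s * (m+1) := by gcongr
    _ = (w+1) * ((m+1) * m.choose s) := by ring
    _ = (w+1) * (m+1).choose (s+1) * (s+1) := by rw [h2]; ring

lemma choose_mul_le2 (w m s : ℕ) (hs : 1 ≤ s) (hw : w ≤ m) :
    (w+1).choose (s+1) * ((m+1) * m) ≤ ((w+1) * w) * (m+1).choose (s+1) := by
  have h1 := Nat.add_one_mul_choose_eq w s
  have h2 := Nat.add_one_mul_choose_eq m s
  have h3 := choose_mul_le w m s hs hw
  refine Nat.le_of_mul_le_mul_right (c := s + 1) ?_ (by omega)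
  calc (w+1).choose (s+1) * ((m+1) * m) * (s+1) 
      = ((w+1).choose (s+1) * (s+1)) * ((m+1) * m) := by ring
    _ = (w+1) * (m+1) * (w.choose s * m) := by rw [← h1]; ring
    _ ≤ (w+1) * (m+1) * (w * m.choose s) := by gcongr
    _ = (w+1) * w * ((m+1) * m.choose s) := by ring
    _ = _ := by rw [h2]; ring

lemma le_choose (z t : ℕ) (hz : 1 ≤ z) (ht : 1 ≤ t) : z + t ≤ (z + t).choose z := by
  have h := choose_mul_le z (z+t) z hz (by omega)
  induction t, ht using Nat.le_induction with
  | base => simp [Nat.choose_succ_self_right]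
  | succ t ht ih =>
    have ih := ih (choose_mul_le z (z+t) z hz (by omega))
    obtain ⟨z, rfl⟩ : ∃ w', z = w' + 1 := ⟨z - 1, by omega⟩
    have : 1 ≤ (z+1+t).choose z := Nat.choose_pos (by omega)
    rw [← add_assoc, Nat.choose_succ_succ]
    simp only [Nat.succ_eq_add_one] at *
    omega

lemma le_choose2 (z t : ℕ) (hz : 2 ≤ z) (ht : 2 ≤ t) :
    (z + t) * (z + t - 1) ≤ 2 * (z + t).choose z := by
  induction t, ht using Nat.le_induction with
  | base =>
    have : (z+2).choose z = (z+2).choose 2 := by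
      rw [← Nat.choose_symm_add]
    rw [this, Nat.choose_two_right]
    have := Nat.two_mul_div_two_of_even (Nat.even_mul_pred_self (z+2))
    omega
  | succ t ht ih =>
    obtain ⟨z, rfl⟩ : ∃ w', z = w' + 1 := ⟨z - 1, by omega⟩
    have h1 := le_choose z (t+1) (by omega) (by omega)
    rw [← add_assoc, Nat.choose_succ_succ]
    have e : z + (t+1) = z+1+t := by ring
    rw [e] at h1
    have : (z + 1 + t + 1) * (z + 1 + t + 1 - 1) = (z+1+t) * (z+1+t-1) + 2 * (z+1+t) := by
      obtain ⟨u, hu⟩ : ∃ u, z + 1 + t = u + 1 := ⟨z + t, by ring⟩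
      rw [hu]; simp; ring
    rw [this]
    simp only [Nat.succ_eq_add_one] at *
    omega

/-- ratio bound -/
lemma ratio1 (v x m s : ℕ) (h1 : x < s) (h2 : s < x + v) (hm : x + v ≤ m) :
    (v.choose (s - x)) * m ≤ v * m.choose s := by
  have a := choose_mul_le v (x+v) (v - (s - x)) (by omega) (by omega)
  have b := choose_mul_le (x+v) m s (by omega) hm
  rw [Nat.choose_symm (by omega)] at a
  have e : (x+v).choose (v - (s-x)) = (x+v).choose s := by
    rw [← Nat.choose_symm (show s ≤ x + v by omega)]; congr 1; omega
  rw [e] at a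
  refine Nat.le_of_mul_le_mul_right (c := x + v) ?_ (by omega)
  calc v.choose (s-x) * m * (x+v) = (v.choose (s-x) * (x+v)) * m := by ring
    _ ≤ v * (x+v).choose s * m := by gcongr
    _ = v * ((x+v).choose s * m) := by ring
    _ ≤ v * ((x+v) * m.choose s) := by gcongr
    _ = _ := by ring

lemma ratio2 (v x m s : ℕ) (hx : 1 ≤ x) (h1 : x < s) (h2 : s < x + v) (hm : x + v ≤ m) :
    (v.choose (s - x)) * (m * (m-1)) ≤ v * (x + v - 1) * m.choose s := by
  have a := choose_mul_le v (x+v) (v - (s - x)) (by omega) (by omega)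
  have b := choose_mul_le2 (x+v-1) (m-1) (s-1) (by omega) (by omega)
  rw [show x + v - 1 + 1 = x + v by omega, show m - 1 + 1 = m by omega,
    show s - 1 + 1 = s by omega] at b
  rw [Nat.choose_symm (by omega)] at a
  have e : (x+v).choose (v - (s-x)) = (x+v).choose s := by
    rw [← Nat.choose_symm (show s ≤ x + v by omega)]; congr 1; omega
  rw [e] at a
  refine Nat.le_of_mul_le_mul_right (c := x + v) ?_ (by omega)
  calc v.choose (s-x) * (m*(m-1)) * (x+v) = (v.choose (s-x) * (x+v)) * (m*(m-1)) := by ring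
    _ ≤ v * (x+v).choose s * (m*(m-1)) := by gcongr
    _ = v * ((x+v).choose s * (m*(m-1))) := by ring
    _ ≤ v * ((x+v) * (x+v-1) * m.choose s) := by gcongr
    _ = _ := by ring

variable {α : Type*} [DecidableEq α]

lemma lym_rel (L : Finset (Finset α)) (X Z : Finset α)
    (hL : ∀ S ∈ L, X ⊆ S ∧ S ⊆ Z) (ha : IsAntichain (· ⊆ ·) (L : Set (Finset α))) :
    ∑ S ∈ L, ((((#Z - #X).choose (#S - #X) : ℕ) : ℝ))⁻¹ ≤ 1 := by
  classical
  let p : α → Prop := fun a => a ∈ Z \ X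
  have key : ∀ S ∈ L, ∀ T ∈ L, S.subtype p ⊆ T.subtype p → S ⊆ T := by
    intro S hS T hT h a haS
    by_cases hX : a ∈ X
    · exact (hL T hT).1 hX
    · have := @h ⟨a, by simp only [p, mem_sdiff]; exact ⟨(hL S hS).2 haS, hX⟩⟩
        (by simpa using haS)
      simpa using this
  have inj : Set.InjOn (fun S => Finset.subtype p S) (L : Set (Finset α)) := by
    intro S hS T hT h
    simp only at h
    exact Subset.antisymm (key S hS T hT h.subset) (key T hT S hS h.symm.subset)
  have := lubell_yamamoto_meshalkin_inequality_sum_inv_choose (𝕜 := ℝ)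
    (𝒜 := L.image (fun S => Finset.subtype p S)) (by
      intro S' hS' T' hT' hne hsub
      simp only [coe_image, Set.mem_image, mem_coe] at hS' hT'
      obtain ⟨S, hS, rfl⟩ := hS'
      obtain ⟨T, hT, rfl⟩ := hT'
      exact ha hS hT (by rintro rfl; exact hne rfl) (key S hS T hT hsub))
  rw [sum_image inj] at this
  refine le_trans (le_of_eq ?_) this
  refine sum_congr rfl fun S hS => ?_
  obtain ⟨h1, h2⟩ := hL S hS
  have c1 : Fintype.card {a // p a} = #Z - #X := by
    rw [Fintype.card_of_subtype (Z \ X) (fun x => Iff.rfl)]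
    exact card_sdiff_of_subset (h1.trans h2)
  have c2 : #(S.subtype p) = #S - #X := by
    rw [card_subtype, ← card_sdiff_of_subset h1]
    congr 1
    ext a
    simp only [p, mem_filter, mem_sdiff]
    constructor
    · tauto
    · intro h; exact ⟨h.1, h2 h.1, h.2⟩
  rw [c2, c1]

/-- incomparability coincides with having the same colour -/
def Weak (V : Finset (Finset α)) (c : Finset α → ℕ) : Prop :=
  ∀ S ∈ V, ∀ T ∈ V, S ≠ T → (c S = c T ↔ ¬ S ⊆ T ∧ ¬ T ⊆ S)

lemma peel (V : Finset (Finset α)) (c : Finset α → ℕ) (hW : Weak V c) (hV : V.Nonempty) :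
    ∃ L R : Finset (Finset α), L.Nonempty ∧ Disjoint L R ∧ L ∪ R = V ∧
      IsAntichain (· ⊆ ·) (L : Set (Finset α)) ∧ ∀ T ∈ R, L.sup id ⊆ T := by
  obtain ⟨S0, hS0, hmin⟩ := exists_min_image V card hV
  refine ⟨V.filter (fun S => c S = c S0), V.filter (fun S => ¬ c S = c S0),
    ⟨S0, by simp [hS0]⟩, disjoint_filter_filter_not _ _ _, filter_union_filter_not_eq _ _, ?_, ?_⟩
  · intro S hS T hT hne
    simp only [coe_filter, Set.mem_ofPred_eq] at hS hT
    exact ((hW S hS.1 T hT.1 hne).1 (hS.2.trans hT.2.symm)).1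
  · intro T hT
    simp only [mem_filter] at hT
    refine Finset.sup_le_iff.2 ?_
    intro S hS
    simp only [mem_filter] at hS
    simp only [id]
    by_contra hST
    have hne : S ≠ T := by rintro rfl; exact hST le_rfl
    have h1 : T ⊆ S := by
      by_contra h
      exact hT.2 ((hW S hS.1 T hT.1 hne).2 ⟨hST, h⟩ ▸ hS.2)
    have hne0 : S0 ≠ T := by rintro rfl; exact hT.2 rfl
    have h2 : S0 ⊆ T := by
      by_contra h
      have h3 : T ⊆ S0 := by
        by_contra h'
        exact hT.2 ((hW S0 hS0 T hT.1 hne0).2 ⟨h, h'⟩).symm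
      exact h (eq_of_subset_of_card_le h3 (hmin T hT.1)).symm.subset
    by_cases e : S0 = S
    · subst e; exact hST h2
    · exact ((hW S0 hS0 S hS.1 e).1 hS.2.symm).1 (h2.trans h1)

end RD
namespace RD
variable {α : Type*} [DecidableEq α]

lemma lsum_gen (L : Finset (Finset α)) (X Z : Finset α) (m : ℕ) (q : ℝ) (hq : 0 ≤ q)
    (hL : ∀ S ∈ L, X ⊂ S ∧ S ⊂ Z) (ha : IsAntichain (· ⊆ ·) (L : Set (Finset α)))
    (hm : #Z ≤ m)
    (hr : ∀ S ∈ L, (((#Z - #X).choose (#S - #X) : ℕ) : ℝ) ≤ q * (m.choose #S : ℕ)) :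
    ∑ S ∈ L, ((m.choose #S : ℕ) : ℝ)⁻¹ ≤ q := by
  have h := lym_rel L X Z (fun S hS => ⟨(hL S hS).1.subset, (hL S hS).2.subset⟩) ha
  calc ∑ S ∈ L, ((m.choose #S : ℕ) : ℝ)⁻¹
      ≤ ∑ S ∈ L, q * ((((#Z - #X).choose (#S - #X) : ℕ) : ℝ))⁻¹ := by
        refine sum_le_sum fun S hS => ?_
        have c1 := card_lt_card (hL S hS).1
        have c2 := card_lt_card (hL S hS).2
        have p1 : (0 : ℝ) < ((#Z - #X).choose (#S - #X) : ℕ) := by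
          exact_mod_cast Nat.choose_pos (by omega)
        have p2 : (0 : ℝ) < (m.choose #S : ℕ) := by
          exact_mod_cast Nat.choose_pos (by omega)
        rw [← div_eq_mul_inv, inv_eq_one_div, div_le_div_iff₀ p2 p1, one_mul]
        exact hr S hS
    _ = q * ∑ S ∈ L, ((((#Z - #X).choose (#S - #X) : ℕ) : ℝ))⁻¹ := by rw [mul_sum]
    _ ≤ q * 1 := by gcongr
    _ = q := mul_one q

lemma lsum1 (L : Finset (Finset α)) (X Z : Finset α) (m : ℕ) (hXZ : X ⊆ Z)
    (hL : ∀ S ∈ L, X ⊂ S ∧ S ⊂ Z) (ha : IsAntichain (· ⊆ ·) (L : Set (Finset α)))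
    (hm : #Z ≤ m) (hm0 : 0 < m) :
    ∑ S ∈ L, ((m.choose #S : ℕ) : ℝ)⁻¹ ≤ ((#Z : ℝ) - #X) / m := by
  have hc := card_le_card hXZ
  have hm0' : (0 : ℝ) < m := by exact_mod_cast hm0
  rw [← Nat.cast_sub hc]
  refine lsum_gen L X Z m _ (by positivity) hL ha hm fun S hS => ?_
  have c1 := card_lt_card (hL S hS).1
  have c2 := card_lt_card (hL S hS).2
  have := ratio1 (#Z - #X) #X m #S c1 (by omega) (by omega)
  rw [div_mul_eq_mul_div, le_div_iff₀ hm0']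
  exact_mod_cast this

lemma lsum2 (L : Finset (Finset α)) (X Z : Finset α) (m : ℕ) (hXZ : X ⊆ Z) (hX : 1 ≤ #X)
    (hL : ∀ S ∈ L, X ⊂ S ∧ S ⊂ Z) (ha : IsAntichain (· ⊆ ·) (L : Set (Finset α)))
    (hm : #Z ≤ m) (hm0 : 2 ≤ m) :
    ∑ S ∈ L, ((m.choose #S : ℕ) : ℝ)⁻¹ ≤ ((#Z : ℝ) - #X) * (#Z - 1) / (m * (m - 1)) := by
  have hc := card_le_card hXZ
  have e : ((#Z : ℝ) - #X) * (#Z - 1) / (m * (m - 1))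
      = (((#Z - #X) * (#Z - 1) : ℕ) : ℝ) / ((m * (m - 1) : ℕ) : ℝ) := by
    rw [Nat.cast_mul, Nat.cast_mul, Nat.cast_sub hc, Nat.cast_sub (by omega),
      Nat.cast_sub (by omega)]
    simp
  have hm0' : (0 : ℝ) < ((m * (m - 1) : ℕ) : ℝ) := by
    have : 0 < m * (m-1) := Nat.mul_pos (by omega) (by omega)
    exact_mod_cast this
  rw [e]
  refine lsum_gen L X Z m _ (by positivity) hL ha hm fun S hS => ?_
  have c1 := card_lt_card (hL S hS).1
  have c2 := card_lt_card (hL S hS).2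
  have := ratio2 (#Z - #X) #X m #S hX c1 (by omega) (by omega)
  rw [show #X + (#Z - #X) - 1 = #Z - 1 by omega] at this
  rw [div_mul_eq_mul_div, le_div_iff₀ hm0']
  exact_mod_cast this

lemma inv_choose_le (m z : ℕ) (h1 : 1 ≤ z) (h2 : z + 1 ≤ m) :
    ((m.choose z : ℕ) : ℝ)⁻¹ ≤ 1 / m := by
  have := le_choose z (m - z) h1 (by omega)
  rw [show z + (m - z) = m by omega] at this
  have hm : (0 : ℝ) < m := by exact_mod_cast (by omega : 0 < m)
  rw [inv_eq_one_div]
  apply one_div_le_one_div_of_le hm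
  exact_mod_cast this

lemma inv_choose_le2 (m z : ℕ) (h1 : 2 ≤ z) (h2 : z + 2 ≤ m) :
    ((m.choose z : ℕ) : ℝ)⁻¹ ≤ 2 / (m * (m - 1)) := by
  have := le_choose2 z (m - z) h1 (by omega)
  rw [show z + (m - z) = m by omega] at this
  have hm : (4 : ℝ) ≤ m := by exact_mod_cast (by omega : 4 ≤ m)
  have h3 : (m : ℝ) * (m - 1) ≤ 2 * (m.choose z : ℕ) := by
    have h4 : ((m * (m-1) : ℕ) : ℝ) ≤ 2 * (m.choose z : ℕ) := by exact_mod_cast this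
    rw [Nat.cast_mul, Nat.cast_sub (by omega)] at h4
    simpa using h4
  have p : (0 : ℝ) < m * (m - 1) := by nlinarith
  have p2 : (0 : ℝ) < (m.choose z : ℕ) := by linarith
  rw [inv_eq_one_div, div_le_div_iff₀ p2 p]
  linarith

theorem weak_bound (K : Finset α) (c : Finset α → ℕ) (hK : 0 < #K) :
    ∀ (N : ℕ) (V : Finset (Finset α)) (X : Finset α), #V = N → X ⊆ K →
      (∀ S ∈ V, X ⊂ S ∧ S ⊂ K) → Weak V c →
      ∑ S ∈ V, (((#K).choose #S : ℕ) : ℝ)⁻¹ ≤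
        ((#K : ℝ) - #X) / #K + (if #X = 0 then 1/6 else 0) := by
  intro N
  induction N using Nat.strong_induction_on with
  | _ N ih =>
  intro V X hN hXK hV hW
  have hm0 : (0 : ℝ) < #K := by exact_mod_cast hK
  have hδ : (0 : ℝ) ≤ (if #X = 0 then 1/6 else 0) := by split_ifs <;> norm_num
  rcases V.eq_empty_or_nonempty with rfl | hne
  · simp only [sum_empty]
    have : (#X : ℝ) ≤ #K := by exact_mod_cast card_le_card hXK
    have : 0 ≤ ((#K : ℝ) - #X) / #K := div_nonneg (by linarith) hm0.le
    linarith
  obtain ⟨L, R, hLne, hdis, hun, hanti, hR⟩ := peel V c hW hne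
  have hLV : L ⊆ V := hun ▸ subset_union_left
  have hRV : R ⊆ V := hun ▸ subset_union_right
  rcases R.eq_empty_or_nonempty with rfl | hRne
  · have : L = V := by simpa using hun
    subst this
    have := lsum1 L X K #K hXK hV hanti le_rfl hK
    linarith
  set Z := L.sup id with hZ
  have hLZ : ∀ S ∈ L, S ⊆ Z := fun S hS => le_sup (f := id) hS
  obtain ⟨S1, hS1⟩ := hLne
  obtain ⟨T1, hT1⟩ := hRne
  have hXZ : X ⊂ Z := (hV S1 (hLV hS1)).1.trans_subset (hLZ S1 hS1)
  have hZK : Z ⊂ K := (hR T1 hT1).trans_ssubset (hV T1 (hRV hT1)).2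
  have cXZ := card_lt_card hXZ
  have cZK := card_lt_card hZK
  have cXZ' : (#X : ℝ) + 1 ≤ #Z := by exact_mod_cast cXZ
  have cZK' : (#Z : ℝ) + 1 ≤ #K := by exact_mod_cast cZK
  rw [← hun, sum_union hdis]
  have hLR : #L + #R = N := by rw [← hN, ← hun, card_union_of_disjoint hdis]
  have hL1 : 1 ≤ #L := card_pos.2 ⟨S1, hS1⟩
  have IH : ∀ R' ⊆ R, Z ∉ R' → ∑ S ∈ R', (((#K).choose #S : ℕ) : ℝ)⁻¹ ≤ ((#K : ℝ) - #Z) / #K := by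
    intro R' hR' hZR
    have := ih #R' (by have := card_le_card hR'; omega) R' Z rfl hZK.subset
      (fun S hS => ⟨(hR S (hR' hS)).ssubset_of_ne (by rintro h; exact hZR (h ▸ hS)),
        (hV S (hRV (hR' hS))).2⟩)
      (fun S hS T hT => hW S (hRV (hR' hS)) T (hRV (hR' hT)))
    rw [if_neg (by omega)] at this
    linarith
  have hsplit : ((#K : ℝ) - #X) / #K = (#Z - #X) / #K + (#K - #Z) / #K := by ring
  by_cases hZL : Z ∈ L
  · have hLs : L = {Z} := by
      refine eq_singleton_iff_unique_mem.2 ⟨hZL, fun S hS => ?_⟩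
      by_contra hne'
      exact hanti hS hZL hne' (hLZ S hS)
    have h2 := IH R le_rfl (fun h => disjoint_left.1 hdis hZL h)
    rw [hLs, sum_singleton]
    have h3 := inv_choose_le #K #Z (by omega) (by omega)
    have h4 : (1 : ℝ) / #K ≤ (#Z - #X) / #K :=
      div_le_div_of_nonneg_right (by linarith) hm0.le
    linarith
  have hLst : ∀ S ∈ L, X ⊂ S ∧ S ⊂ Z := fun S hS =>
    ⟨(hV S (hLV hS)).1, (hLZ S hS).ssubset_of_ne (by rintro h; exact hZL (h ▸ hS))⟩
  have hl1 := lsum1 L X Z #K hXZ.subset hLst hanti cZK.le hK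
  by_cases hZR : Z ∈ R
  · rw [← add_sum_erase R _ hZR]
    have h2 := IH (R.erase Z) (erase_subset _ _) (notMem_erase _ _)
    have d1 := card_lt_card (hLst S1 hS1).1
    have d2 := card_lt_card (hLst S1 hS1).2
    by_cases hlast : #Z + 1 = #K
    · have hemp : R.erase Z = ∅ := by
        refine eq_empty_of_forall_notMem fun T hT => ?_
        rw [mem_erase] at hT
        have e1 := card_lt_card ((hR T hT.2).ssubset_of_ne hT.1.symm)
        have e2 := card_lt_card (hV T (hRV hT.2)).2
        omega
      rw [hemp, sum_empty]
      have h3 := inv_choose_le #K #Z (by omega) (by omega)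
      have h4 : (1 : ℝ) / #K ≤ (#K - #Z) / #K :=
        div_le_div_of_nonneg_right (by linarith) hm0.le
      linarith
    · have h3 := inv_choose_le2 #K #Z (by omega) (by omega)
      have hK4 : (4 : ℝ) ≤ #K := by exact_mod_cast (by omega : 4 ≤ #K)
      have p : (0 : ℝ) < #K * (#K - 1) := by nlinarith
      by_cases hx : #X = 0
      · rw [if_pos hx]
        have : (2 : ℝ) / (#K * (#K - 1)) ≤ 1/6 := by
          rw [div_le_div_iff₀ p (by norm_num)]; nlinarith
        linarith
      · rw [if_neg hx]
        have hl2 := lsum2 L X Z #K hXZ.subset (by omega) hLst hanti cZK.le (by omega)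
        have hv : (#X : ℝ) + 2 ≤ #Z := by exact_mod_cast (by omega : #X + 2 ≤ #Z)
        have : ((#Z : ℝ) - #X) * (#Z - 1) / (#K * (#K - 1)) + 2 / (#K * (#K - 1))
            ≤ (#Z - #X) / #K := by
          rw [← add_div, div_le_div_iff₀ p hm0]
          have : ((#Z : ℝ) - #X) * (#Z - 1) + 2 ≤ (#Z - #X) * (#K - 1) := by nlinarith
          nlinarith
        linarith
  · have h2 := IH R le_rfl hZR
    linarith

end RD
namespace RD
open Numbering
variable {α : Type*} [DecidableEq α] [Fintype α]

open Classical in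
/-- numberings whose lowest prefix in `F` is `A` and whose highest one is `D` -/
noncomputable def GG (F : Finset (Finset α)) (A D : Finset α) : Finset (Numbering α) :=
  univ.filter (fun f => IsPrefix f A ∧ IsPrefix f D ∧ (∀ T ∈ F, T ⊂ A → ¬ IsPrefix f T) ∧
    (∀ T ∈ F, D ⊂ T → ¬ IsPrefix f T))

lemma mem_GG {F : Finset (Finset α)} {A D : Finset α} {f : Numbering α} :
    f ∈ GG F A D ↔ IsPrefix f A ∧ IsPrefix f D ∧ (∀ T ∈ F, T ⊂ A → ¬ IsPrefix f T) ∧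
    (∀ T ∈ F, D ⊂ T → ¬ IsPrefix f T) := by
  simp [GG]

lemma pfx_swap (f : Numbering α) (x y : α) (T T' : Finset α) (hc : #T = #T')
    (h : ∀ z, z ∈ T ↔ Equiv.swap x y z ∈ T') :
    IsPrefix ((Equiv.swap x y).trans f) T ↔ IsPrefix f T' := by
  unfold IsPrefix
  constructor
  · intro hf z
    have := hf (Equiv.swap x y z)
    rw [h, Equiv.swap_apply_self, Equiv.trans_apply, Equiv.swap_apply_self, hc] at this
    exact this
  · intro hf z
    rw [h, hf, hc]; rfl

lemma pfx_swap_self (f : Numbering α) (x y : α) (T : Finset α) (h : x ∈ T ↔ y ∈ T) :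
    IsPrefix ((Equiv.swap x y).trans f) T ↔ IsPrefix f T := by
  refine pfx_swap f x y T T rfl fun z => ?_
  rw [Equiv.swap_apply_def]
  split_ifs with h1 h2
  · rw [h1, h]
  · rw [h2, h]
  · rfl

lemma GG_swap (F : Finset (Finset α)) (A D : Finset α) (hAD : A ⊆ D) (f : Numbering α) (x y : α)
    (hx : x ∈ D) (hx' : x ∉ A) (hy : y ∈ D) (hy' : y ∉ A) :
    (Equiv.swap x y).trans f ∈ GG F A D ↔ f ∈ GG F A D := by
  rw [mem_GG, mem_GG, pfx_swap_self f x y A (by tauto), pfx_swap_self f x y D (by tauto)]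
  have h1 : ∀ T, T ⊂ A → (IsPrefix ((Equiv.swap x y).trans f) T ↔ IsPrefix f T) := fun T hT =>
    pfx_swap_self f x y T ⟨fun h => (hx' (hT.subset h)).elim, fun h => (hy' (hT.subset h)).elim⟩
  have h2 : ∀ T, D ⊂ T → (IsPrefix ((Equiv.swap x y).trans f) T ↔ IsPrefix f T) := fun T hT =>
    pfx_swap_self f x y T ⟨fun _ => hT.subset hy, fun _ => hT.subset hx⟩
  constructor
  · rintro ⟨a, b, c, d⟩
    exact ⟨a, b, fun T hT h => by rw [← h1 T h]; exact c T hT h,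
      fun T hT h => by rw [← h2 T h]; exact d T hT h⟩
  · rintro ⟨a, b, c, d⟩
    exact ⟨a, b, fun T hT h => by rw [h1 T h]; exact c T hT h,
      fun T hT h => by rw [h2 T h]; exact d T hT h⟩

/-- number of numberings in `GG` having `S` as a prefix -/
noncomputable def NN (F : Finset (Finset α)) (A D S : Finset α) : ℕ :=
  #((GG F A D).filter (fun f => IsPrefix f S))

lemma NN_swap (F : Finset (Finset α)) (A D S : Finset α) (hAS : A ⊆ S) (hSD : S ⊆ D) (x y : α)
    (hx : x ∈ S) (hx' : x ∉ A) (hy : y ∈ D) (hy' : y ∉ S) :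
    NN F A D S = NN F A D (insert y (S.erase x)) := by
  have hxy : x ≠ y := by rintro rfl; exact hy' hx
  have hcard : #S = #(insert y (S.erase x)) := by
    rw [card_insert_of_notMem (by simp [hy']), card_erase_add_one hx]
  have hsw : ∀ f : Numbering α, IsPrefix ((Equiv.swap x y).trans f) S ↔
      IsPrefix f (insert y (S.erase x)) := fun f => by
    refine pfx_swap f x y _ _ hcard fun z => ?_
    rw [Equiv.swap_apply_def]
    split_ifs with h1 h2
    · simp [h1, hx]
    · subst h2; simp [hy', hxy]
    · simp [h1, h2]
  have hG := fun f => GG_swap F A D (hAS.trans hSD) f x y (hSD hx) hx' hy (fun h => hy' (hAS h))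
  unfold NN
  have inv : ∀ f : Numbering α, (Equiv.swap x y).trans ((Equiv.swap x y).trans f) = f := by
    intro f; ext z; simp
  refine card_bij' (fun f _ => (Equiv.swap x y).trans f) (fun f _ => (Equiv.swap x y).trans f)
    ?_ ?_ (fun f _ => inv f) (fun f _ => inv f)
  · intro f hf
    rw [mem_filter] at hf ⊢
    exact ⟨(hG f).2 hf.1, by rw [← hsw, inv]; exact hf.2⟩
  · intro f hf
    rw [mem_filter] at hf ⊢
    exact ⟨(hG f).2 hf.1, by rw [hsw]; exact hf.2⟩

lemma NN_eq (F : Finset (Finset α)) (A D S' : Finset α) (hAS' : A ⊆ S') (hSD' : S' ⊆ D) :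
    ∀ (k : ℕ) (S : Finset α), #(S \ S') = k → A ⊆ S → S ⊆ D → #S = #S' →
      NN F A D S = NN F A D S' := by
  intro k
  induction k with
  | zero =>
    intro S hk hAS hSD hc
    rw [card_eq_zero, sdiff_eq_empty_iff_subset] at hk
    rw [eq_of_subset_of_card_le hk hc.ge]
  | succ k ih =>
    intro S hk hAS hSD hc
    obtain ⟨x, hx⟩ : (S \ S').Nonempty := card_pos.1 (by omega)
    have h2 : #(S' \ S) = #(S \ S') := (card_sdiff_comm hc).symm
    obtain ⟨y, hy⟩ : (S' \ S).Nonempty := card_pos.1 (by omega)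
    rw [mem_sdiff] at hx hy
    rw [NN_swap F A D S hAS hSD x y hx.1 (fun h => hx.2 (hAS' h)) (hSD' hy.1) hy.2]
    apply ih
    · have : insert y (S.erase x) \ S' = (S \ S').erase x := by
        ext z; simp only [mem_sdiff, mem_insert, mem_erase]
        constructor
        · rintro ⟨rfl | h, h'⟩
          · exact (h' hy.1).elim
          · tauto
        · tauto
      rw [this, card_erase_of_mem (mem_sdiff.2 hx), hk]; rfl
    · intro a ha
      rw [mem_insert, mem_erase]
      exact Or.inr ⟨by rintro rfl; exact hx.2 (hAS' ha), hAS ha⟩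
    · intro a ha
      rw [mem_insert, mem_erase] at ha
      rcases ha with rfl | ha
      · exact hSD' hy.1
      · exact hSD ha.2
    · rw [card_insert_of_notMem (by simp [hy.2]), card_erase_add_one hx.1, hc]

lemma exists_pfx_set (f : Numbering α) (s : ℕ) (hs : s ≤ Fintype.card α) :
    ∃ S : Finset α, #S = s ∧ IsPrefix f S := by
  have : #(univ.filter (fun x => (f x : ℕ) < s)) = s := by
    rw [← card_map f.toEmbedding]
    have : (univ.filter (fun x => (f x : ℕ) < s)).map f.toEmbedding
        = univ.filter (fun i : Fin (Fintype.card α) => (i : ℕ) < s) := by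
      ext i; simp only [mem_map_equiv, mem_filter, mem_univ, true_and, Equiv.apply_symm_apply]
    rw [this, Fin.card_filter_val_lt, min_eq_right hs]
  exact ⟨_, this, fun x => by rw [this]; simp⟩

lemma pfx_unique {f : Numbering α} {S T : Finset α} (hS : IsPrefix f S) (hT : IsPrefix f T)
    (h : #S = #T) : S = T :=
  Subset.antisymm (hS.subset_of_card_le_card hT h.le) (hT.subset_of_card_le_card hS h.ge)

lemma card_between (A D : Finset α) (hAD : A ⊆ D) (s : ℕ) (h1 : #A ≤ s) :
    #(univ.filter (fun S : Finset α => (A ⊆ S ∧ S ⊆ D) ∧ #S = s))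
      = (#D - #A).choose (s - #A) := by
  rw [← card_sdiff_of_subset hAD, ← card_powersetCard]
  refine card_bij' (fun S _ => S \ A) (fun S _ => S ∪ A) ?_ ?_ ?_ ?_
  · intro S hS
    simp only [mem_filter, mem_univ, true_and] at hS
    rw [mem_powersetCard, card_sdiff_of_subset hS.1.1, hS.2]
    exact ⟨sdiff_subset_sdiff hS.1.2 le_rfl, rfl⟩
  · intro S hS
    rw [mem_powersetCard, subset_sdiff] at hS
    simp only [mem_filter, mem_univ, true_and]
    rw [card_union_of_disjoint hS.1.2, hS.2]
    exact ⟨⟨subset_union_right, union_subset hS.1.1 hAD⟩, by omega⟩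
  · intro S hS
    simp only [mem_filter, mem_univ, true_and] at hS
    exact sdiff_union_of_subset hS.1.1
  · intro S hS
    rw [mem_powersetCard, subset_sdiff] at hS
    rw [union_sdiff_right]; exact sdiff_eq_self_of_disjoint hS.1.2

lemma NN_mul (F : Finset (Finset α)) (A D S : Finset α) (hAS : A ⊆ S) (hSD : S ⊆ D) :
    NN F A D S * (#D - #A).choose (#S - #A) = #(GG F A D) := by
  classical
  rw [← card_between A D (hAS.trans hSD) #S (card_le_card hAS)]
  set W := univ.filter (fun S' : Finset α => (A ⊆ S' ∧ S' ⊆ D) ∧ #S' = #S) with hW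
  have h1 : ∑ S' ∈ W, NN F A D S' = NN F A D S * #W := by
    rw [sum_congr rfl (g := fun _ => NN F A D S), sum_const, smul_eq_mul, mul_comm]
    intro S' hS'
    simp only [hW, mem_filter, mem_univ, true_and] at hS'
    exact NN_eq F A D S hAS hSD _ S' rfl hS'.1.1 hS'.1.2 hS'.2
  rw [← h1]
  unfold NN
  simp_rw [card_filter]
  rw [sum_comm, card_eq_sum_ones]
  refine sum_congr rfl fun f hf => ?_
  rw [← card_filter, card_eq_one]
  obtain ⟨S0, hc, hp⟩ := exists_pfx_set f #S (card_le_univ S)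
  rw [mem_GG] at hf
  refine ⟨S0, eq_singleton_iff_unique_mem.2 ⟨?_, ?_⟩⟩
  · simp only [hW, mem_filter, mem_univ, true_and]
    refine ⟨⟨⟨hf.1.subset_of_card_le_card hp ?_, hp.subset_of_card_le_card hf.2.1 ?_⟩, hc⟩, hp⟩
    · rw [hc]; exact card_le_card hAS
    · rw [hc]; exact card_le_card hSD
  · intro T hT
    simp only [hW, mem_filter, mem_univ, true_and] at hT
    exact pfx_unique hT.2 hp (hT.1.2.trans hc.symm)

/-- members of `F` strictly between `A` and `D` -/
def mid (F : Finset (Finset α)) (A D : Finset α) : Finset (Finset α) :=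
  F.filter (fun S => A ⊂ S ∧ S ⊂ D)

lemma mid_bound (F : Finset (Finset α)) (c : Finset α → ℕ) (A D : Finset α) (hAD : A ⊂ D)
    (hW : Weak (mid F A D) c) :
    ∑ S ∈ mid F A D, (NN F A D S : ℝ) ≤ 7/6 * #(GG F A D) := by
  have hm : ∀ S ∈ mid F A D, A ⊂ S ∧ S ⊂ D := fun S hS => (mem_filter.1 hS).2
  have h1 : ∀ S ∈ mid F A D, (NN F A D S : ℝ) =
      #(GG F A D) * (((#(D \ A)).choose #(S \ A) : ℕ) : ℝ)⁻¹ := by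
    intro S hS
    obtain ⟨a, b⟩ := hm S hS
    have := NN_mul F A D S a.subset b.subset
    have p : (0 : ℝ) < (((#(D \ A)).choose #(S \ A) : ℕ) : ℝ) := by
      exact_mod_cast Nat.choose_pos (card_le_card (sdiff_subset_sdiff b.subset le_rfl))
    rw [← div_eq_mul_inv, eq_div_iff p.ne', card_sdiff_of_subset a.subset,
      card_sdiff_of_subset hAD.subset]
    exact_mod_cast this
  rw [sum_congr rfl h1, ← mul_sum, mul_comm]
  have key : ∀ S ∈ mid F A D, S \ A ∪ A = S := fun S hS => sdiff_union_of_subset (hm S hS).1.subset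
  have hsub : ∀ S ∈ mid F A D, ∀ T ∈ mid F A D, (S \ A ⊆ T \ A ↔ S ⊆ T) := by
    intro S hS T hT
    constructor
    · intro h
      rw [← key S hS, ← key T hT]; exact union_subset_union h le_rfl
    · intro h; exact sdiff_subset_sdiff h le_rfl
  have inj : Set.InjOn (fun S => S \ A) (mid F A D : Set (Finset α)) := by
    intro S hS T hT h
    simp only at h
    rw [← key S hS, ← key T hT, h]
  have hc : 0 < #(D \ A) := by
    rw [card_sdiff_of_subset hAD.subset]; have := card_lt_card hAD; omega
  have h2 := weak_bound (D \ A) (fun T => c (T ∪ A)) hc _ ((mid F A D).image (fun S => S \ A)) ∅ rfl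
    (empty_subset _) (by
      intro S' hS'
      obtain ⟨S, hS, rfl⟩ := mem_image.1 hS'
      obtain ⟨a, b⟩ := hm S hS
      constructor
      · rw [empty_ssubset, sdiff_nonempty]; exact a.not_subset
      · refine (sdiff_subset_sdiff b.subset le_rfl).ssubset_of_ne fun h => ?_
        apply b.ne
        rw [← key S hS, h, sdiff_union_of_subset hAD.subset]) (by
      intro S' hS' T' hT' hne
      obtain ⟨S, hS, rfl⟩ := mem_image.1 hS'
      obtain ⟨T, hT, rfl⟩ := mem_image.1 hT'
      simp only [key S hS, key T hT]
      rw [hsub S hS T hT, hsub T hT S hS]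
      exact hW S hS T hT (by rintro rfl; exact hne rfl))
  rw [sum_image inj] at h2
  have hc' : (#(D \ A) : ℝ) ≠ 0 := by exact_mod_cast hc.ne'
  simp only [card_empty, Nat.cast_zero, sub_zero, div_self hc', if_true] at h2
  refine mul_le_mul_of_nonneg_right (h2.trans (by norm_num)) (by positivity)

open Classical in
/-- number of members of `F` that are prefixes of `f` -/
noncomputable def hits (F : Finset (Finset α)) (f : Numbering α) : Finset (Finset α) :=
  F.filter (fun S => IsPrefix f S)

lemma hits_bound (F : Finset (Finset α)) (f : Numbering α) :
    (#(hits F f)) ≤ 2 + ∑ p ∈ (F ×ˢ F).filter (fun p => p.1 ⊂ p.2),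
      if f ∈ GG F p.1 p.2 then #((mid F p.1 p.2).filter (fun S => IsPrefix f S)) else 0 := by
  by_cases h2 : #(hits F f) ≤ 1
  · omega
  have hm : ∀ S, S ∈ hits F f ↔ S ∈ F ∧ IsPrefix f S := fun S => by simp [hits]
  have hne : (hits F f).Nonempty := card_pos.1 (by omega)
  obtain ⟨A, hA, hAmin⟩ := exists_min_image (hits F f) card hne
  obtain ⟨D, hD, hDmax⟩ := exists_max_image (hits F f) card hne
  have hA' := (hm A).1 hA
  have hD' := (hm D).1 hD
  have hlow : ∀ S ∈ hits F f, A ⊆ S := fun S hS =>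
    hA'.2.subset_of_card_le_card ((hm S).1 hS).2 (hAmin S hS)
  have hhigh : ∀ S ∈ hits F f, S ⊆ D := fun S hS =>
    ((hm S).1 hS).2.subset_of_card_le_card hD'.2 (hDmax S hS)
  have hAD : A ⊂ D := by
    refine (hlow D hD).ssubset_of_ne ?_
    rintro rfl
    obtain ⟨S, hS, T, hT, hST⟩ := one_lt_card.1 (by omega : 1 < #(hits F f))
    exact hST ((Subset.antisymm (hhigh S hS) (hlow S hS)).trans
      (Subset.antisymm (hlow T hT) (hhigh T hT)))
  have hG : f ∈ GG F A D := by
    rw [mem_GG]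
    refine ⟨hA'.2, hD'.2, fun T hT h hp => ?_, fun T hT h hp => ?_⟩
    · exact h.not_subset (hlow T ((hm T).2 ⟨hT, hp⟩))
    · exact h.not_subset (hhigh T ((hm T).2 ⟨hT, hp⟩))
  have hs : hits F f ⊆ insert A (insert D ((mid F A D).filter (fun S => IsPrefix f S))) := by
    intro S hS
    rw [mem_insert, mem_insert]
    by_cases e1 : S = A
    · exact Or.inl e1
    by_cases e2 : S = D
    · exact Or.inr (Or.inl e2)
    refine Or.inr (Or.inr (mem_filter.2 ⟨mem_filter.2 ⟨((hm S).1 hS).1, ?_, ?_⟩, ((hm S).1 hS).2⟩))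
    · exact (hlow S hS).ssubset_of_ne (Ne.symm e1)
    · exact (hhigh S hS).ssubset_of_ne e2
  have c1 := card_le_card hs
  have c2 := card_insert_le A (insert D ((mid F A D).filter (fun S => IsPrefix f S)))
  have c3 := card_insert_le D ((mid F A D).filter (fun S => IsPrefix f S))
  have c4 := single_le_sum (f := fun p : Finset α × Finset α =>
      if f ∈ GG F p.1 p.2 then #((mid F p.1 p.2).filter (fun S => IsPrefix f S)) else 0)
    (s := (F ×ˢ F).filter (fun p => p.1 ⊂ p.2)) (fun _ _ => Nat.zero_le _)
    (a := (A, D)) (by simp [hA'.1, hD'.1, hAD])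
  simp only [hG, if_true] at c4
  omega

lemma GG_unique (F : Finset (Finset α)) (f : Numbering α) :
    #(((F ×ˢ F).filter (fun p => p.1 ⊂ p.2)).filter (fun p => f ∈ GG F p.1 p.2)) ≤ 1 := by
  rw [card_le_one]
  rintro ⟨A, D⟩ h ⟨A', D'⟩ h'
  simp only [mem_filter, mem_product, mem_GG] at h h'
  obtain ⟨⟨⟨hA, hD⟩, -⟩, pA, pD, lA, lD⟩ := h
  obtain ⟨⟨⟨hA', hD'⟩, -⟩, pA', pD', lA', lD'⟩ := h'
  have eA : A = A' := by
    by_contra hne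
    rcases Nat.le_total #A #A' with h | h
    · exact lA' A hA ((pA.subset_of_card_le_card pA' h).ssubset_of_ne hne) pA
    · exact lA A' hA' ((pA'.subset_of_card_le_card pA h).ssubset_of_ne (Ne.symm hne)) pA'
  have eD : D = D' := by
    by_contra hne
    rcases Nat.le_total #D #D' with h | h
    · exact lD D' hD' ((pD.subset_of_card_le_card pD' h).ssubset_of_ne hne) pD'
    · exact lD' D hD ((pD'.subset_of_card_le_card pD h).ssubset_of_ne (Ne.symm hne)) pD
  rw [eA, eD]

theorem lubell_bound (F : Finset (Finset α)) (c : Finset α → ℕ)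
    (hW : ∀ A ∈ F, ∀ D ∈ F, A ⊂ D → Weak (mid F A D) c) :
    ∑ S ∈ F, (((Fintype.card α).choose #S : ℕ) : ℝ)⁻¹ ≤ 19/6 := by
  classical
  set P := (F ×ˢ F).filter (fun p => p.1 ⊂ p.2) with hP
  set Ω : ℝ := (Fintype.card (Numbering α) : ℝ) with hΩ
  have hΩ0 : 0 < Ω := by
    rw [hΩ, Fintype.card_numbering]; exact_mod_cast Nat.factorial_pos _
  have e1 : ∑ f : Numbering α, #(hits F f) = ∑ S ∈ F, #(prefixed S) := by
    unfold hits prefixed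
    simp_rw [card_filter]
    rw [sum_comm]
  have e2 : ∀ S ∈ F, (#(prefixed S) : ℝ) = Ω * (((Fintype.card α).choose #S : ℕ) : ℝ)⁻¹ := by
    intro S _
    have p : (0 : ℝ) < (((Fintype.card α).choose #S : ℕ) : ℝ) := by
      exact_mod_cast Nat.choose_pos (card_le_univ S)
    rw [← div_eq_mul_inv, eq_div_iff p.ne', hΩ, Fintype.card_numbering, card_prefixed]
    have := Nat.choose_mul_factorial_mul_factorial (card_le_univ S)
    rw [← this]; push_cast; ring
  have e3 : ∑ f : Numbering α, ∑ p ∈ P,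
      (if f ∈ GG F p.1 p.2 then #((mid F p.1 p.2).filter (fun S => IsPrefix f S)) else 0)
      = ∑ p ∈ P, ∑ S ∈ mid F p.1 p.2, NN F p.1 p.2 S := by
    rw [sum_comm]
    refine sum_congr rfl fun p _ => ?_
    rw [← sum_filter, filter_mem_eq_inter, univ_inter]
    unfold NN
    simp_rw [card_filter]
    rw [sum_comm]
  have e4 : ∑ p ∈ P, #(GG F p.1 p.2) ≤ Fintype.card (Numbering α) := by
    calc ∑ p ∈ P, #(GG F p.1 p.2) = ∑ p ∈ P, ∑ f : Numbering α, if f ∈ GG F p.1 p.2 then 1 else 0 := by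
          refine sum_congr rfl fun p _ => ?_
          rw [← card_filter, filter_mem_eq_inter, univ_inter]
      _ = ∑ f : Numbering α, #(P.filter (fun p => f ∈ GG F p.1 p.2)) := by
          rw [sum_comm]; simp_rw [card_filter]
      _ ≤ ∑ f : Numbering α, 1 := sum_le_sum fun f _ => GG_unique F f
      _ = _ := by simp
  have e4' : ∑ p ∈ P, (#(GG F p.1 p.2) : ℝ) ≤ Ω := by rw [hΩ]; exact_mod_cast e4
  have e5 : ∑ S ∈ F, #(prefixed S) ≤ 2 * Fintype.card (Numbering α) +
      ∑ p ∈ P, ∑ S ∈ mid F p.1 p.2, NN F p.1 p.2 S := by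
    rw [← e1, ← e3]
    refine (sum_le_sum fun f _ => hits_bound F f).trans (le_of_eq ?_)
    rw [sum_add_distrib, sum_const, smul_eq_mul, card_univ, mul_comm]
  have e5' : ∑ S ∈ F, (#(prefixed S) : ℝ) ≤ 2 * Ω +
      ∑ p ∈ P, ∑ S ∈ mid F p.1 p.2, (NN F p.1 p.2 S : ℝ) := by
    rw [hΩ]; exact_mod_cast e5
  have e6 : ∑ p ∈ P, ∑ S ∈ mid F p.1 p.2, (NN F p.1 p.2 S : ℝ) ≤
      ∑ p ∈ P, 7/6 * (#(GG F p.1 p.2) : ℝ) := by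
    refine sum_le_sum fun p hp => ?_
    simp only [hP, mem_filter, mem_product] at hp
    exact mid_bound F c p.1 p.2 hp.2 (hW p.1 hp.1.1 p.2 hp.1.2 hp.2)
  rw [← mul_sum] at e6
  rw [sum_congr rfl e2, ← mul_sum] at e5'
  have : Ω * ∑ S ∈ F, (((Fintype.card α).choose #S : ℕ) : ℝ)⁻¹ ≤ Ω * (19/6) := by linarith
  exact le_of_mul_le_mul_left this hΩ0

end RD
namespace RD

lemma weak_of_avoids (n : ℕ) (F : Finset (Finset (Fin n))) (c : Finset (Fin n) → ℕ)
    (hc : FamilyProperColoring n F c)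
    (hr : ¬∃ f : Diamond → Finset (Fin n), FamilyCopy n F Diamond f ∧ Function.Injective (c ∘ f)) :
    ∀ A ∈ F, ∀ D ∈ F, A ⊂ D → Weak (mid F A D) c := by
  intro A hA D hD hAD B hB C hC hBC
  simp only [mid, mem_filter] at hB hC
  obtain ⟨hB, hAB, hBD⟩ := hB
  obtain ⟨hC, hAC, hCD⟩ := hC
  constructor
  · intro h
    exact ⟨fun h' => hc B hB C hC hBC h' h, fun h' => hc C hC B hB hBC.symm h' h.symm⟩
  · rintro ⟨h1, h2⟩
    by_contra hne
    apply hr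
    have cAB := hc A hA B hB hAB.ne hAB.subset
    have cAC := hc A hA C hC hAC.ne hAC.subset
    have cAD := hc A hA D hD hAD.ne hAD.subset
    have cBD := hc B hB D hD hBD.ne hBD.subset
    have cCD := hc C hC D hD hCD.ne hCD.subset
    let f : Fin 4 → Finset (Fin n) := ![A, B, C, D]
    have hinj : ∀ i j : Fin 4, c (f i) = c (f j) → i = j := by
      intro i j h
      fin_cases i <;> fin_cases j <;> simp [f] at h ⊢ <;> omega
    have hle : ∀ i j : Fin 4, f i ⊆ f j ↔ DiamondRel i j := by
      intro i j
      fin_cases i <;> fin_cases j <;>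
        simp [f, DiamondRel, h1, h2, hAB.subset, hAC.subset, hAD.subset, hBD.subset, hCD.subset,
          hAB.not_subset, hAC.not_subset, hAD.not_subset, hBD.not_subset, hCD.not_subset]
    have hmem : ∀ i : Fin 4, f i ∈ F := by
      intro i; fin_cases i <;> simp [f, hA, hB, hC, hD]
    exact ⟨f, ⟨hmem, fun i j h => hinj i j (by rw [h]), hle⟩, fun i j h => hinj i j h⟩

lemma upper (n : ℕ) (F : Finset (Finset (Fin n))) (h : AvoidsRainbow n Diamond F) :
    (#F : ℝ) ≤ 19/6 * (n.choose (n/2)) := by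
  obtain ⟨c, hc, hr⟩ := h
  have h1 := lubell_bound F c (weak_of_avoids n F c hc hr)
  rw [Fintype.card_fin] at h1
  have hp : (0 : ℝ) < (n.choose (n/2) : ℕ) := by
    exact_mod_cast Nat.choose_pos (Nat.div_le_self n 2)
  have h2 : (#F : ℝ) * ((n.choose (n/2) : ℕ) : ℝ)⁻¹ ≤ ∑ S ∈ F, ((n.choose #S : ℕ) : ℝ)⁻¹ := by
    rw [← nsmul_eq_mul, ← sum_const]
    refine sum_le_sum fun S _ => ?_
    have : (0 : ℝ) < (n.choose #S : ℕ) := by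
      exact_mod_cast Nat.choose_pos (by simpa using card_le_univ S)
    rw [inv_le_inv₀ hp this]
    exact_mod_cast Nat.choose_le_middle _ _
  have h3 := h2.trans h1
  rwa [← div_eq_mul_inv, div_le_iff₀ hp] at h3

lemma bdd (n : ℕ) : BddAbove {m : ℕ | ∃ 𝓕 : Finset (Finset (Fin n)), 𝓕.card = m ∧
    AvoidsRainbow n Diamond 𝓕} :=
  ⟨Fintype.card (Finset (Fin n)), by rintro m ⟨F, rfl, -⟩; exact card_le_univ F⟩

lemma upper' (n : ℕ) : (LaR n Diamond : ℝ) ≤ 19/6 * (n.choose (n/2)) := by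
  have hne : {m : ℕ | ∃ 𝓕 : Finset (Finset (Fin n)), 𝓕.card = m ∧
    AvoidsRainbow n Diamond 𝓕}.Nonempty := by
    refine ⟨0, ∅, rfl, fun _ => 0, fun A hA => by simp at hA, ?_⟩
    rintro ⟨f, hf, -⟩
    have := hf.1 (0 : Fin 4)
    simp at this
  obtain ⟨F, hF, hA⟩ := Nat.sSup_mem hne (bdd n)
  have := upper n F hA
  unfold LaR
  rw [← hF]; exact this

lemma lower (n h : ℕ) (hh : 1 ≤ h) :
    n.choose (h - 1) + n.choose h + n.choose (h + 1) ≤ LaR n Diamond := by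
  apply le_csSup (bdd n)
  refine ⟨powersetCard (h-1) univ ∪ powersetCard h univ ∪ powersetCard (h+1) univ, ?_, card, ?_, ?_⟩
  · rw [card_union_of_disjoint, card_union_of_disjoint]
    · simp
    · exact pairwise_disjoint_powersetCard _ (by omega)
    · rw [disjoint_union_left]
      exact ⟨pairwise_disjoint_powersetCard _ (by omega),
        pairwise_disjoint_powersetCard _ (by omega)⟩
  · intro A _ B _ hne hsub hcard
    exact hne (eq_of_subset_of_card_le hsub hcard.ge)
  · rintro ⟨f, hf, hinj⟩
    have hmem : ∀ p, (card ∘ f) p ∈ ({h-1, h, h+1} : Finset ℕ) := by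
      intro p
      have := hf.1 p
      simp only [mem_union, mem_powersetCard_univ] at this
      simp only [Function.comp, mem_insert, mem_singleton]
      tauto
    have h1 := card_le_card_of_injOn (s := (univ : Finset Diamond)) (card ∘ f)
      (fun p _ => hmem p) hinj.injOn
    have h2 : #(univ : Finset Diamond) = 4 := Fintype.card_fin 4
    have h3 : #({h-1, h, h+1} : Finset ℕ) ≤ 3 := card_le_three
    omega

lemma lower_real (n : ℕ) (ε : ℝ) (hε : 0 < ε) (hn : 2 ≤ n) (hn' : 4 ≤ ε * ((n / 2 : ℕ) : ℝ)) :
    (3 - ε) * (n.choose (n / 2)) ≤ (LaR n Diamond : ℝ) := by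
  obtain ⟨k, hk⟩ : ∃ k, n / 2 = k + 1 := ⟨n/2 - 1, by omega⟩
  have hl := lower n (n/2) (by omega)
  rw [hk] at hl hn' ⊢
  simp only [Nat.add_sub_cancel] at hl
  have a1 := Nat.choose_succ_right_eq n k
  have a2 := Nat.choose_succ_right_eq n (k+1)
  have b1 : n.choose (k+1) * (k+1) ≤ n.choose k * (k+3) := by
    rw [a1]; exact Nat.mul_le_mul_left _ (by omega)
  have b2 : n.choose (k+1) * (k+1) ≤ n.choose (k+1+1) * (k+3) := by
    calc n.choose (k+1) * (k+1) ≤ n.choose (k+1) * (n - (k+1)) :=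
          Nat.mul_le_mul_left _ (by omega)
      _ = _ := a2.symm
      _ ≤ _ := Nat.mul_le_mul_left _ (by omega)
  have hl' : (n.choose k : ℝ) + n.choose (k+1) + n.choose (k+1+1) ≤ LaR n Diamond := by
    exact_mod_cast hl
  have b1' : (n.choose (k+1) : ℝ) * (k+1) ≤ n.choose k * (k+3) := by exact_mod_cast b1
  have b2' : (n.choose (k+1) : ℝ) * (k+1) ≤ n.choose (k+1+1) * (k+3) := by exact_mod_cast b2
  push_cast at hn'
  set C : ℝ := (n.choose (k+1) : ℝ) with hC
  have hC0 : 0 ≤ C := by positivity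
  have hk3 : (0 : ℝ) < k + 3 := by positivity
  suffices h : (2 - ε) * C * (k+3) ≤ ((n.choose k : ℝ) + n.choose (k+1+1)) * (k+3) by
    have := le_of_mul_le_mul_right h hk3
    linarith
  have h4 : (2 - ε) * (k+3) ≤ 2 * ((k : ℝ)+1) := by nlinarith
  nlinarith

end RD

/-- For every `ε > 0` there exists `n₀` such that for all `n ≥ n₀`,
`(3 - ε) · C(n, ⌊n/2⌋) ≤ La_R^*(n, ◊) ≤ (19/6 + ε) · C(n, ⌊n/2⌋)`. -/
theorem statement17 (ε : ℝ) (hε : 0 < ε) :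
    ∃ n₀ : ℕ, ∀ n, n₀ ≤ n →
      (3 - ε) * (n.choose (n / 2)) ≤ (LaR n Diamond : ℝ) ∧
      (LaR n Diamond : ℝ) ≤ (19 / 6 + ε) * (n.choose (n / 2)) := by
  obtain ⟨N, hN⟩ := exists_nat_ge (4 / ε)
  refine ⟨2 * N + 2, fun n hn => ⟨?_, ?_⟩⟩
  · refine RD.lower_real n ε hε (by omega) ?_
    have h1 : (N : ℝ) ≤ ((n / 2 : ℕ) : ℝ) := by exact_mod_cast (by omega : N ≤ n / 2)
    rw [div_le_iff₀ hε] at hN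
    nlinarith
  · have := RD.upper' n
    have h0 : (0 : ℝ) ≤ n.choose (n/2) := by positivity
    nlinarith
end
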